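/- arXiv:1405.4993 — 2 statements merged into one kernel-verified Lean document; each statement's English description precedes it below -/
import Mathlib

section
/- Let K be a convex body in ℝ^n with centroid at the origin and let Λ be a lattice of rank n in ℝ^n. Then vol(K)/det Λ ≤ 4^n·∏_{i=1}^n 1/λ_i(K,Λ). -/
open MeasureTheory Set Filter Pointwise RealInnerProductSpace
open scoped ENNReal

noncomputable section

namespace Paper

/-- Euclidean space `ℝ^n`. -/
abbrev Euc (n : ℕ) := EuclideanSpace ℝ (Fin n)

variable {n : ℕ}

/-- A convex body: a compact convex set with non-empty interior. -/
def IsConvexBody (K : Set (Euc n)) : Prop :=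
  Convex ℝ K ∧ IsCompact K ∧ (interior K).Nonempty

/-- The centroid of `K` lies at the origin, i.e. `∫_K x dx = 0`. -/
def CentroidAtOrigin (K : Set (Euc n)) : Prop :=
  (∫ x in K, x) = (0 : Euc n)

/-- The lattice generated by the family `b`. -/
def latticeOf (b : Fin n → Euc n) : Set (Euc n) :=
  {x | ∃ z : Fin n → ℤ, x = ∑ i, (z i : ℝ) • b i}

/-- The determinant of the lattice generated by `b`. -/
def latticeDet (b : Fin n → Euc n) : ℝ :=
  |Matrix.det (Matrix.of fun i j => b j i)|

/-- The integer lattice `ℤ^n` inside `ℝ^n`. -/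
def stdLattice (n : ℕ) : Set (Euc n) :=
  {x | ∀ i, ∃ m : ℤ, x i = (m : ℝ)}

/-- `succMin K Λ i` is the `i`-th successive minimum
`λ_i(K,Λ) = inf {t > 0 : t•K contains at least i linearly independent points of Λ}`. -/
def succMin (K Λ : Set (Euc n)) (i : ℕ) : ℝ :=
  sInf {t : ℝ | 0 < t ∧ ∃ v : Fin i → Euc n,
    LinearIndependent ℝ v ∧ ∀ j, v j ∈ Λ ∧ v j ∈ t • K}

/-- Surface area of a convex body, via the (outer) Minkowski content. -/
def surfaceArea (K : Set (Euc n)) : ℝ :=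
  limUnder (nhdsWithin (0 : ℝ) (Ioi 0)) fun ε =>
    ((volume (Metric.cthickening ε K)).toReal - (volume K).toReal) / ε

/-- The `k`-th elementary symmetric function of `ρ 0, …, ρ (n-1)`. -/
def esym (n k : ℕ) (ρ : Fin n → ℝ) : ℝ :=
  ∑ J ∈ Finset.powersetCard k (Finset.univ : Finset (Fin n)), ∏ i ∈ J, ρ i

/-- A rational polytope: convex hull of finitely many points with rational coordinates. -/
def IsRationalPolytope (P : Set (Euc n)) : Prop :=
  ∃ V : Finset (Euc n), (∀ v ∈ V, ∀ i, ∃ q : ℚ, v i = (q : ℝ)) ∧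
    P = convexHull ℝ (V : Set (Euc n))

/-- A lattice polytope: convex hull of finitely many points of `ℤ^n`. -/
def IsLatticePolytope (P : Set (Euc n)) : Prop :=
  ∃ V : Finset (Euc n), (∀ v ∈ V, v ∈ stdLattice n) ∧
    P = convexHull ℝ (V : Set (Euc n))

/-- `F` is a facet of `P`: an `(n-1)`-dimensional face cut out by a supporting hyperplane. -/
def IsFacet (P F : Set (Euc n)) : Prop :=
  ∃ (a : Euc n) (b : ℝ), a ≠ 0 ∧ (∀ x ∈ P, ⟪a, x⟫ ≤ b) ∧
    F = {x | x ∈ P ∧ ⟪a, x⟫ = b} ∧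
    Module.finrank ℝ (affineSpan ℝ F).direction = n - 1

/-- The determinant of a `k`-dimensional lattice `L ⊆ ℝ^n` (given as a set of points):
the square root of the Gram determinant of any ℤ-basis of `L`. -/
def sublatticeDetOf (k : ℕ) (L : Set (Euc n)) : ℝ :=
  sInf {d : ℝ | ∃ c : Fin k → Euc n, LinearIndependent ℝ c ∧
    L = {x | ∃ z : Fin k → ℤ, x = ∑ i, (z i : ℝ) • c i} ∧
    d = Real.sqrt (Matrix.det (Matrix.of fun i j => ⟪c i, c j⟫))}

/-- The lattice surface area
`lE_{n-1}(P) = (1/2) ∑_{F facet of P} vol_{n-1}(F) / det(aff₀(F) ∩ ℤ^n)`,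
where `vol_{n-1}` is realized by the `(n-1)`-dimensional Hausdorff measure. -/
def latticeSurfaceArea (P : Set (Euc n)) : ℝ :=
  (1/2) * ∑ᶠ F ∈ {F : Set (Euc n) | IsFacet P F},
    (μH[(n : ℝ) - 1] F).toReal /
      sublatticeDetOf (n - 1) (((affineSpan ℝ F).direction : Set (Euc n)) ∩ stdLattice n)

/-- `D_i(Λ)`: the minimal determinant of an `i`-dimensional sublattice of `Λ`. -/
def minSublatticeDet (Λ : Set (Euc n)) (i : ℕ) : ℝ :=
  sInf {d : ℝ | ∃ c : Fin i → Euc n, LinearIndependent ℝ c ∧ (∀ j, c j ∈ Λ) ∧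
    d = Real.sqrt (Matrix.det (Matrix.of fun k l => ⟪c k, c l⟫))}

/-- `D_min(Λ) = min {D_i(Λ)^(1/i) : 1 ≤ i ≤ n}`. -/
def Dmin (Λ : Set (Euc n)) : ℝ :=
  sInf {d : ℝ | ∃ i : Fin n, d = minSublatticeDet Λ ((i : ℕ) + 1) ^ ((1 : ℝ) / ((i : ℕ) + 1))}

/-- The polar lattice `Λ^⋆ = {x : ⟨x,y⟩ ∈ ℤ for all y ∈ Λ}`. -/
def polarLattice (Λ : Set (Euc n)) : Set (Euc n) :=
  {x | ∀ y ∈ Λ, ∃ m : ℤ, ⟪x, y⟫ = (m : ℝ)}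

/-- The standard cross-polytope `C_n^⋆ = conv{±e_1, …, ±e_n}`. -/
def crossPolytope (n : ℕ) : Set (Euc n) :=
  convexHull ℝ ((Set.range fun i : Fin n => EuclideanSpace.single i (1 : ℝ)) ∪
    (Set.range fun i : Fin n => -EuclideanSpace.single i (1 : ℝ)))

/-- The standard simplex `S_n = conv{0, e_1, …, e_n}`. -/
def stdSimplexSet (n : ℕ) : Set (Euc n) :=
  convexHull ℝ (insert 0 (Set.range fun i : Fin n => EuclideanSpace.single i (1 : ℝ)))

/-- The all-ones vector `𝟙 = (1,…,1)`. -/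
def allOnes (n : ℕ) : Euc n := WithLp.toLp 2 fun _ => (1 : ℝ)

/-- The simplex `T_n = -𝟙 + (n+1) S_n`. -/
def Tn (n : ℕ) : Set (Euc n) :=
  (fun x => ((n : ℝ) + 1) • x - allOnes n) '' stdSimplexSet n


lemma bm1_compact {A B S : Set ℝ} (hA : IsCompact A) (hB : IsCompact B) (hA0 : A.Nonempty)
    (hB0 : B.Nonempty) (hS : ∀ a ∈ A, ∀ b ∈ B, a + b ∈ S) :
    volume A + volume B ≤ volume S := by
  obtain ⟨a1, ha1, ha1'⟩ := hA.exists_isGreatest hA0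
  obtain ⟨b0, hb0, hb0'⟩ := hB.exists_isLeast hB0
  have h1 : volume (b0 +ᵥ A) = volume A := measure_vadd volume b0 A
  have h2 : volume (a1 +ᵥ B) = volume B := measure_vadd volume a1 B
  rw [← h1, ← h2, ← measure_union₀]
  · apply measure_mono
    rintro x (hx | hx)
    · obtain ⟨a, ha, rfl⟩ := hx
      have := hS a ha b0 hb0
      simpa [vadd_eq_add, add_comm] using this
    · obtain ⟨a, ha, rfl⟩ := hx
      have := hS a1 ha1 a ha
      simpa [vadd_eq_add, add_comm] using this
  · exact (hB.vadd a1).measurableSet.nullMeasurableSet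
  · refine measure_mono_null (t := {a1 + b0}) ?_ (by simp)
    rintro x ⟨⟨a, ha, rfl⟩, ⟨b, hb, hab⟩⟩
    have h3 := ha1' ha
    have h4 := hb0' hb
    simp only [vadd_eq_add, mem_singleton_iff] at *
    linarith

lemma bm1 {A B S : Set ℝ} (hA : MeasurableSet A) (hB : MeasurableSet B) (hA0 : A.Nonempty)
    (hB0 : B.Nonempty) (hS : ∀ a ∈ A, ∀ b ∈ B, a + b ∈ S) :
    volume A + volume B ≤ volume S := by
  have hA' : volume A = ⨆ (K : Set ℝ) (_ : K ⊆ A ∧ IsCompact K ∧ K.Nonempty), volume K := by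
    apply le_antisymm
    · apply le_of_forall_lt
      intro r hr
      obtain ⟨K, hKA, hK, hrK⟩ := hA.exists_lt_isCompact hr
      have : K.Nonempty := by
        rw [nonempty_iff_ne_empty]; rintro rfl; simp at hrK
      exact hrK.trans_le (le_iSup₂_of_le K ⟨hKA, hK, this⟩ le_rfl)
    · exact iSup₂_le fun K hK => measure_mono hK.1
  have hB' : volume B = ⨆ (K : Set ℝ) (_ : K ⊆ B ∧ IsCompact K ∧ K.Nonempty), volume K := by
    apply le_antisymm
    · apply le_of_forall_lt
      intro r hr
      obtain ⟨K, hKA, hK, hrK⟩ := hB.exists_lt_isCompact hr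
      have : K.Nonempty := by
        rw [nonempty_iff_ne_empty]; rintro rfl; simp at hrK
      exact hrK.trans_le (le_iSup₂_of_le K ⟨hKA, hK, this⟩ le_rfl)
    · exact iSup₂_le fun K hK => measure_mono hK.1
  obtain ⟨a, ha⟩ := hA0
  obtain ⟨b, hb⟩ := hB0
  rw [hA', hB']
  refine ENNReal.biSup_add_biSup_le' ⟨{a}, by simpa using ha⟩ ⟨{b}, by simpa using hb⟩ ?_
  intro K hK L hL
  exact bm1_compact hK.2.1 hL.2.1 hK.2.2 hL.2.2 fun x hx y hy => hS x (hK.1 hx) y (hL.1 hy)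

lemma bm1w {A B S : Set ℝ} (hA : MeasurableSet A) (hB : MeasurableSet B) (hA0 : A.Nonempty)
    (hB0 : B.Nonempty) {s t : ℝ} (hs : 0 < s) (ht : 0 < t)
    (hS : ∀ a ∈ A, ∀ b ∈ B, s * a + t * b ∈ S) :
    ENNReal.ofReal s * volume A + ENNReal.ofReal t * volume B ≤ volume S := by
  have h1 : volume (s • A) = ENNReal.ofReal s * volume A := by
    rw [Measure.addHaar_smul]; simp [abs_of_pos hs]
  have h2 : volume (t • B) = ENNReal.ofReal t * volume B := by
    rw [Measure.addHaar_smul]; simp [abs_of_pos ht]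
  rw [← h1, ← h2]
  apply bm1 (hA.const_smul₀ s) (hB.const_smul₀ t) hA0.smul_set hB0.smul_set
  rintro _ ⟨a, ha, rfl⟩ _ ⟨b, hb, rfl⟩
  exact hS a ha b hb

lemma pl1_norm {F G H : ℝ → ℝ} (hF : Measurable F) (hG : Measurable G) (hH : Measurable H)
    (F0 : ∀ x, 0 ≤ F x) (G0 : ∀ x, 0 ≤ G x) (H0 : ∀ x, 0 ≤ H x)
    (F1 : ∀ x, F x ≤ 1) (G1 : ∀ x, G x ≤ 1)
    (Fs : ∀ l < 1, ∃ x, l < F x) (Gs : ∀ l < 1, ∃ x, l < G x)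
    {s t : ℝ} (hs : 0 < s) (ht : 0 < t) (hst : s + t = 1)
    (h : ∀ x y, F x ^ s * G y ^ t ≤ H (s * x + t * y)) :
    ENNReal.ofReal s * (∫⁻ x, ENNReal.ofReal (F x)) + ENNReal.ofReal t * (∫⁻ x, ENNReal.ofReal (G x))
      ≤ ∫⁻ x, ENNReal.ofReal (H x) := by
  rw [lintegral_eq_lintegral_meas_lt _ (ae_of_all _ F0) hF.aemeasurable,
    lintegral_eq_lintegral_meas_lt _ (ae_of_all _ G0) hG.aemeasurable,
    lintegral_eq_lintegral_meas_lt _ (ae_of_all _ H0) hH.aemeasurable]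
  have mF : Measurable fun l : ℝ => volume {a | l < F a} :=
    Antitone.measurable fun a b hab => measure_mono fun x hx => lt_of_le_of_lt hab hx
  have mG : Measurable fun l : ℝ => volume {a | l < G a} :=
    Antitone.measurable fun a b hab => measure_mono fun x hx => lt_of_le_of_lt hab hx
  rw [← lintegral_const_mul _ mF, ← lintegral_const_mul _ mG, ← lintegral_add_left (mF.const_mul _)]
  apply setLIntegral_mono' measurableSet_Ioi
  intro l hl
  have hl0 : 0 < l := hl
  rcases lt_or_ge l 1 with hl1 | hl1
  · apply bm1w (measurableSet_lt measurable_const hF) (measurableSet_lt measurable_const hG)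
      (Fs l hl1) (Gs l hl1) hs ht
    intro a ha b hb
    refine lt_of_lt_of_le ?_ (h a b)
    calc l = l ^ s * l ^ t := by rw [← Real.rpow_add hl0, hst, Real.rpow_one]
      _ < F a ^ s * G b ^ t := by
        apply mul_lt_mul'' (Real.rpow_lt_rpow hl0.le ha hs) (Real.rpow_lt_rpow hl0.le hb ht) <;>
          positivity
  · have e1 : {a | l < F a} = ∅ := by
      ext x; simpa using (F1 x).trans hl1
    have e2 : {a | l < G a} = ∅ := by
      ext x; simpa using (G1 x).trans hl1
    simp [e1, e2]

lemma amgm (a b : ℝ≥0∞) {s t : ℝ} (hs : 0 < s) (ht : 0 < t) (hst : s + t = 1) :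
    a ^ s * b ^ t ≤ ENNReal.ofReal s * a + ENNReal.ofReal t * b := by
  have hpq : (s⁻¹).HolderConjugate t⁻¹ := by
    rw [Real.holderConjugate_iff]
    constructor
    · exact (one_lt_inv₀ hs).2 (by linarith)
    · simpa using hst
  have := ENNReal.young_inequality (a ^ s) (b ^ t) hpq
  rw [← ENNReal.rpow_mul, ← ENNReal.rpow_mul, mul_inv_cancel₀ hs.ne', mul_inv_cancel₀ ht.ne',
    ENNReal.rpow_one, ENNReal.rpow_one, ENNReal.ofReal_inv_of_pos hs, ENNReal.ofReal_inv_of_pos ht,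
    div_eq_mul_inv, div_eq_mul_inv, inv_inv, inv_inv] at this
  rwa [mul_comm a, mul_comm b] at this

lemma pl1_bdd {f g h : ℝ → ℝ≥0∞} (hf : Measurable f) (hg : Measurable g) (hh : Measurable h)
    {N : ℝ≥0∞} (hN : N ≠ ⊤) (fN : ∀ x, f x ≤ N) (gN : ∀ x, g x ≤ N) (hN' : ∀ x, h x ≤ N)
    {s t : ℝ} (hs : 0 < s) (ht : 0 < t) (hst : s + t = 1)
    (H : ∀ x y, f x ^ s * g y ^ t ≤ h (s * x + t * y)) :
    (∫⁻ x, f x) ^ s * (∫⁻ x, g x) ^ t ≤ ∫⁻ x, h x := by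
  set a := ⨆ x, f x with ha
  set b := ⨆ x, g x with hb
  have haN : a ≤ N := iSup_le fN
  have hbN : b ≤ N := iSup_le gN
  have hat : a ≠ ⊤ := ne_top_of_le_ne_top hN haN
  have hbt : b ≠ ⊤ := ne_top_of_le_ne_top hN hbN
  rcases eq_or_ne a 0 with h0 | ha0
  · have : ∀ x, f x = 0 := by simpa [ha] using h0
    simp [this, hs]
  rcases eq_or_ne b 0 with h0 | hb0
  · have : ∀ x, g x = 0 := by simpa [hb] using h0
    simp [this, ht]
  set c := a ^ s * b ^ t with hc
  have hc0 : c ≠ 0 := by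
    refine mul_ne_zero ?_ ?_
    · simp [ENNReal.rpow_eq_zero_iff, ha0, hat]
    · simp [ENNReal.rpow_eq_zero_iff, hb0, hbt]
  have hct : c ≠ ⊤ := by
    refine ENNReal.mul_ne_top ?_ ?_
    · exact ENNReal.rpow_ne_top_of_nonneg hs.le hat
    · exact ENNReal.rpow_ne_top_of_nonneg ht.le hbt
  have fle : ∀ x, f x / a ≤ 1 := fun x => ENNReal.div_le_of_le_mul (by simpa using le_iSup f x)
  have gle : ∀ x, g x / b ≤ 1 := fun x => ENNReal.div_le_of_le_mul (by simpa using le_iSup g x)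
  have ftop : ∀ x, f x / a ≠ ⊤ := fun x => ne_top_of_le_ne_top (by simp) (fle x)
  have gtop : ∀ x, g x / b ≠ ⊤ := fun x => ne_top_of_le_ne_top (by simp) (gle x)
  have htop : ∀ x, h x / c ≠ ⊤ := fun x => ENNReal.div_ne_top (ne_top_of_le_ne_top hN (hN' x)) hc0
  have sup : ∀ (u : ℝ → ℝ≥0∞) (d : ℝ≥0∞), d = (⨆ x, u x) → d ≠ 0 → d ≠ ⊤ → (∀ x, u x / d ≠ ⊤) →
      ∀ l < (1:ℝ), ∃ x, l < (u x / d).toReal := by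
    intro u d hd hd0 hdt hut l hl
    rcases lt_or_ge l 0 with hl0 | hl0
    · exact ⟨0, hl0.trans_le ENNReal.toReal_nonneg⟩
    have : ENNReal.ofReal l * d < ⨆ x, u x := by
      rw [← hd]
      calc ENNReal.ofReal l * d < 1 * d := by
            rw [ENNReal.mul_lt_mul_iff_left hd0 hdt]; simpa using hl
        _ = d := one_mul d
    obtain ⟨x, hx⟩ := lt_iSup_iff.1 this
    refine ⟨x, ?_⟩
    rw [← ENNReal.ofReal_lt_iff_lt_toReal hl0 (hut x)]
    rwa [ENNReal.lt_div_iff_mul_lt (Or.inl hd0) (Or.inl hdt)]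
  have key := pl1_norm (F := fun x => (f x / a).toReal) (G := fun x => (g x / b).toReal)
    (H := fun x => (h x / c).toReal) (hf.div_const a).ennreal_toReal
    (hg.div_const b).ennreal_toReal (hh.div_const c).ennreal_toReal
    (fun _ => ENNReal.toReal_nonneg) (fun _ => ENNReal.toReal_nonneg)
    (fun _ => ENNReal.toReal_nonneg)
    (fun x => ENNReal.toReal_le_of_le_ofReal zero_le_one (by simpa using fle x))
    (fun x => ENNReal.toReal_le_of_le_ofReal zero_le_one (by simpa using gle x))
    (sup f a ha ha0 hat ftop) (sup g b hb hb0 hbt gtop) hs ht hst (by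
      intro x y
      rw [ENNReal.toReal_rpow, ENNReal.toReal_rpow, ← ENNReal.toReal_mul]
      apply ENNReal.toReal_mono (htop _)
      rw [ENNReal.div_rpow_of_nonneg _ _ hs.le, ENNReal.div_rpow_of_nonneg _ _ ht.le]
      rw [ENNReal.le_div_iff_mul_le (Or.inl hc0) (Or.inl hct)]
      refine le_trans (le_of_eq ?_) (H x y)
      rw [hc, mul_mul_mul_comm, ENNReal.div_mul_cancel, ENNReal.div_mul_cancel]
      · simp [ENNReal.rpow_eq_zero_iff, hb0, hbt]
      · exact ENNReal.rpow_ne_top_of_nonneg ht.le hbt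
      · simp [ENNReal.rpow_eq_zero_iff, ha0, hat]
      · exact ENNReal.rpow_ne_top_of_nonneg hs.le hat)
  simp only [ENNReal.ofReal_toReal (ftop _), ENNReal.ofReal_toReal (gtop _),
    ENNReal.ofReal_toReal (htop _)] at key
  have key2 := (amgm _ _ hs ht hst).trans key
  simp only [div_eq_mul_inv] at key2
  rw [lintegral_mul_const _ hf, lintegral_mul_const _ hg, lintegral_mul_const _ hh,
    ← div_eq_mul_inv, ← div_eq_mul_inv, ← div_eq_mul_inv,
    ENNReal.div_rpow_of_nonneg _ _ hs.le, ENNReal.div_rpow_of_nonneg _ _ ht.le,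
    ENNReal.le_div_iff_mul_le (Or.inl hc0) (Or.inl hct), hc, mul_mul_mul_comm,
    ENNReal.div_mul_cancel, ENNReal.div_mul_cancel] at key2
  · exact key2
  · simp [ENNReal.rpow_eq_zero_iff, hb0, hbt]
  · exact ENNReal.rpow_ne_top_of_nonneg ht.le hbt
  · simp [ENNReal.rpow_eq_zero_iff, ha0, hat]
  · exact ENNReal.rpow_ne_top_of_nonneg hs.le hat

lemma tendsto_lintegral_min {f : ℝ → ℝ≥0∞} (hf : Measurable f) :
    Tendsto (fun N : ℕ => ∫⁻ x, min (f x) N) atTop (nhds (∫⁻ x, f x)) := by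
  apply lintegral_tendsto_of_tendsto_of_monotone
  · intro n; exact (hf.min measurable_const).aemeasurable
  · exact ae_of_all _ fun x a b hab => min_le_min le_rfl (by exact_mod_cast hab)
  · refine ae_of_all _ fun x => ?_
    have := (tendsto_const_nhds (x := f x)).min ENNReal.tendsto_nat_nhds_top
    simpa using this

lemma pl1 {f g h : ℝ → ℝ≥0∞} (hf : Measurable f) (hg : Measurable g) (hh : Measurable h)
    {s t : ℝ} (hs : 0 < s) (ht : 0 < t) (hst : s + t = 1)
    (H : ∀ x y, f x ^ s * g y ^ t ≤ h (s * x + t * y)) :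
    (∫⁻ x, f x) ^ s * (∫⁻ x, g x) ^ t ≤ ∫⁻ x, h x := by
  rcases eq_or_ne (∫⁻ x, f x) 0 with h0 | hf0
  · simp [h0, hs]
  rcases eq_or_ne (∫⁻ x, g x) 0 with h0 | hg0
  · simp [h0, ht]
  have t1 : Tendsto (fun N : ℕ => (∫⁻ x, min (f x) N) ^ s * (∫⁻ x, min (g x) N) ^ t) atTop
      (nhds ((∫⁻ x, f x) ^ s * (∫⁻ x, g x) ^ t)) := by
    apply ENNReal.Tendsto.mul
    · exact (ENNReal.continuous_rpow_const.tendsto _).comp (tendsto_lintegral_min hf)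
    · left; simp [ENNReal.rpow_eq_zero_iff, hf0, hs.le]
    · exact (ENNReal.continuous_rpow_const.tendsto _).comp (tendsto_lintegral_min hg)
    · left; simp [ENNReal.rpow_eq_zero_iff, hg0, ht.le]
  refine le_of_tendsto t1 (Eventually.of_forall fun N => ?_)
  refine (pl1_bdd (h := fun x => min (h x) N) (hf.min measurable_const) (hg.min measurable_const)
    (hh.min measurable_const) (N := N) (by simp) (fun x => min_le_right _ _)
    (fun x => min_le_right _ _) (fun x => min_le_right _ _) hs ht hst ?_).trans
    (lintegral_mono fun x => min_le_left _ _)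
  intro x y
  apply le_min
  · exact le_trans (mul_le_mul' (ENNReal.rpow_le_rpow (min_le_left _ _) hs.le)
      (ENNReal.rpow_le_rpow (min_le_left _ _) ht.le)) (H x y)
  · refine le_trans (mul_le_mul' (ENNReal.rpow_le_rpow (min_le_right _ _) hs.le)
      (ENNReal.rpow_le_rpow (min_le_right _ _) ht.le)) ?_
    rw [← ENNReal.rpow_add_of_nonneg _ _ hs.le ht.le, hst, ENNReal.rpow_one]

lemma pl (n : ℕ) {s t : ℝ} (hs : 0 < s) (ht : 0 < t) (hst : s + t = 1) :
    ∀ {f g h : (Fin n → ℝ) → ℝ≥0∞} (_ : Measurable f) (_ : Measurable g) (_ : Measurable h)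
    (_ : ∀ x y, f x ^ s * g y ^ t ≤ h (s • x + t • y)),
    (∫⁻ x, f x) ^ s * (∫⁻ x, g x) ^ t ≤ ∫⁻ x, h x := by
  induction n with
  | zero =>
    intro f g h hf hg hh H
    have e : (volume : Measure (Fin 0 → ℝ)) = Measure.dirac 0 := by
      rw [volume_pi, Measure.pi_of_empty _ 0]
    rw [e, lintegral_dirac' _ hf, lintegral_dirac' _ hg, lintegral_dirac' _ hh]
    simpa using H 0 0
  | succ n ih =>
    intro f g h hf hg hh H
    have e := (volume_preserving_piFinSuccAbove (fun _ : Fin (n+1) => ℝ) 0).symm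
    set φ := (MeasurableEquiv.piFinSuccAbove (fun _ : Fin (n+1) => ℝ) 0).symm with hφ
    have conv : ∀ u : (Fin (n+1) → ℝ) → ℝ≥0∞, Measurable u →
        ∫⁻ x, u x = ∫⁻ a : ℝ, ∫⁻ y : Fin n → ℝ, u (φ (a, y)) := by
      intro u hu
      rw [← e.lintegral_comp hu]
      exact lintegral_prod _ (hu.comp φ.measurable).aemeasurable
    have m1 : ∀ u : (Fin (n+1) → ℝ) → ℝ≥0∞, Measurable u →
        Measurable fun a : ℝ => ∫⁻ y : Fin n → ℝ, u (φ (a, y)) := by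
      intro u hu
      exact (hu.comp φ.measurable).lintegral_prod_right'
    rw [conv f hf, conv g hg, conv h hh]
    apply pl1 (m1 f hf) (m1 g hg) (m1 h hh) hs ht hst
    intro a b
    apply ih (hf.comp (φ.measurable.comp measurable_prodMk_left))
      (hg.comp (φ.measurable.comp measurable_prodMk_left))
      (hh.comp (φ.measurable.comp measurable_prodMk_left))
    intro x y
    refine (H _ _).trans (le_of_eq ?_)
    congr 1
    ext i
    refine Fin.cases ?_ (fun j => ?_) i <;> simp [hφ, MeasurableEquiv.piFinSuccAbove]

lemma bm_euc {n : ℕ} {A B S : Set (Euc n)} (hA : MeasurableSet A) (hB : MeasurableSet B)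
    (hS : MeasurableSet S) {s t : ℝ} (hs : 0 < s) (ht : 0 < t) (hst : s + t = 1)
    (H : ∀ a ∈ A, ∀ b ∈ B, s • a + t • b ∈ S) :
    volume A ^ s * volume B ^ t ≤ volume S := by
  have mp := PiLp.volume_preserving_toLp (Fin n)
  have key : ∀ X : Set (Euc n), MeasurableSet X →
      volume X = ∫⁻ x : Fin n → ℝ, X.indicator 1 (WithLp.toLp 2 x) := by
    intro X hX
    rw [mp.lintegral_comp (f := X.indicator 1) (measurable_one.indicator hX), lintegral_indicator_one hX]
  rw [key A hA, key B hB, key S hS]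
  apply pl n hs ht hst
  · exact (measurable_one.indicator hA).comp mp.measurable
  · exact (measurable_one.indicator hB).comp mp.measurable
  · exact (measurable_one.indicator hS).comp mp.measurable
  · intro x y
    by_cases hx : WithLp.toLp 2 x ∈ A
    · by_cases hy : WithLp.toLp 2 y ∈ B
      · have := H _ hx _ hy
        simp [hx, hy, this]
      · simp [hy, ht]
    · simp [hx, hs]

lemma supergrad {E : Type*} [NormedAddCommGroup E] [NormedSpace ℝ E] [FiniteDimensional ℝ E]
    {U : Set E} (hU : IsOpen U) {φ : E → ℝ} (hφ : ConcaveOn ℝ U φ) (h0 : (0 : E) ∈ U) :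
    ∃ L : E →L[ℝ] ℝ, ∀ w ∈ U, φ w ≤ φ 0 + L w := by
  have hc := hφ.continuousOn hU
  let S : Set (E × ℝ) := {p | p.1 ∈ U ∧ p.2 < φ p.1}
  have hSc : Convex ℝ S := hφ.convex_strict_hypograph
  have hSo : IsOpen S := by
    have h1 : ContinuousOn (fun p : E × ℝ => φ p.1 - p.2) (U ×ˢ univ) := by
      apply ContinuousOn.sub
      · exact hc.comp continuousOn_fst (fun p hp => hp.1)
      · exact continuousOn_snd
    have := h1.isOpen_inter_preimage (hU.prod isOpen_univ) (isOpen_Ioi (a := (0:ℝ)))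
    convert this using 1
    ext p; simp [S]
  have hn : ((0 : E), φ 0) ∉ S := by simp [S]
  obtain ⟨f, hf⟩ := geometric_hahn_banach_open_point hSc hSo hn
  have hdec : ∀ w r, f (w, r) = f (w, 0) + r * f (0, 1) := by
    intro w r
    have : (w, r) = (w, (0:ℝ)) + r • ((0:E), (1:ℝ)) := by simp
    rw [this, map_add, map_smul, smul_eq_mul]
  set τ := f ((0:E), (1:ℝ)) with hτ
  have hτ0 : 0 < τ := by
    have := hf (0, φ 0 - 1) ⟨h0, by simp⟩
    rw [hdec 0 (φ 0), hdec 0 (φ 0 - 1)] at this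
    linarith
  refine ⟨-(τ⁻¹ • (f.comp (ContinuousLinearMap.inl ℝ E ℝ))), ?_⟩
  intro w hw
  apply le_of_forall_lt
  intro r hr
  have := hf (w, r) ⟨hw, hr⟩
  rw [hdec 0 (φ 0), hdec w r] at this
  have h00 : f ((0:E), (0:ℝ)) = 0 := by
    have : ((0:E), (0:ℝ)) = 0 := rfl
    rw [this, map_zero]
  simp only [neg_apply, smul_apply,
    ContinuousLinearMap.comp_apply, ContinuousLinearMap.inl_apply, smul_eq_mul]
  have h3 : τ⁻¹ * (f (w, 0) + r * τ) < τ⁻¹ * (φ 0 * τ) := by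
    apply mul_lt_mul_of_pos_left _ (inv_pos.2 hτ0)
    rw [h00] at this; linarith
  have h4 : τ⁻¹ * (f (w, 0) + r * τ) = τ⁻¹ * f (w, 0) + r := by field_simp
  have h5 : τ⁻¹ * (φ 0 * τ) = φ 0 := by field_simp
  linarith

lemma zero_mem_interior {K : Set (Euc n)} (hc : Convex ℝ K) (hK : IsCompact K)
    (hi : (interior K).Nonempty) (hcen : (∫ x in K, x) = (0 : Euc n)) : (0 : Euc n) ∈ interior K := by
  by_contra h0
  obtain ⟨f, hf⟩ := geometric_hahn_banach_open_point hc.interior isOpen_interior h0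
  rw [map_zero] at hf
  have hint : IntegrableOn (fun x : Euc n => x) K := continuousOn_id.integrableOn_compact hK
  have h1 : ∫ x in K, f x = 0 := by
    rw [f.integral_comp_comm hint, hcen, map_zero]
  have hneg : ∀ x ∈ K, f x ≤ 0 := by
    have : K ⊆ closure (interior K) := by
      rw [hc.closure_interior_eq_closure_of_nonempty_interior hi]; exact subset_closure
    intro x hx
    have h2 : closure (interior K) ⊆ {x | f x ≤ 0} :=
      closure_minimal (fun y hy => (hf y hy).le) (isClosed_le f.continuous continuous_const)
    exact h2 (this hx)
  have h2 : 0 < ∫ x in K, -f x := by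
    rw [setIntegral_pos_iff_support_of_nonneg_ae]
    · have : interior K ⊆ Function.support (fun x => -f x) ∩ K := by
        intro x hx
        refine ⟨?_, interior_subset hx⟩
        have := hf x hx
        simp only [Function.mem_support]; linarith
      exact (isOpen_interior.measure_pos volume hi).trans_le (measure_mono this)
    · rw [EventuallyLE, ae_restrict_iff' hK.measurableSet]
      exact ae_of_all _ fun x hx => by simpa using hneg x hx
    · exact (f.continuous.neg.continuousOn).integrableOn_compact hK
  rw [integral_neg, h1] at h2
  simp at h2

/-- the set `K ∩ (2w - K)` -/
def refl2 (K : Set (Euc n)) (w : Euc n) : Set (Euc n) := {x | x ∈ K ∧ (2:ℝ) • w - x ∈ K}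

lemma refl2_closed {K : Set (Euc n)} (hK : IsCompact K) (w : Euc n) : IsClosed (refl2 K w) :=
  hK.isClosed.inter (hK.isClosed.preimage (by fun_prop : Continuous fun x => (2:ℝ) • w - x))

lemma refl2_ne_top {K : Set (Euc n)} (hK : IsCompact K) (w : Euc n) : volume (refl2 K w) ≠ ⊤ :=
  ne_top_of_le_ne_top hK.measure_ne_top (measure_mono fun _ hx => hx.1)

lemma refl2_pos {K : Set (Euc n)} {w : Euc n} (hw : w ∈ interior K) :
    0 < volume (refl2 K w) := by
  have ho : IsOpen (interior K ∩ (fun x => (2:ℝ) • w - x) ⁻¹' interior K) :=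
    isOpen_interior.inter (isOpen_interior.preimage (by fun_prop))
  refine (ho.measure_pos volume ⟨w, hw, ?_⟩).trans_le
    (measure_mono fun x hx => ⟨interior_subset hx.1, interior_subset hx.2⟩)
  have : (2:ℝ) • w - w = w := by rw [two_smul]; abel
  simpa [this] using hw

lemma refl2_logconcave {K : Set (Euc n)} (hc : Convex ℝ K) (hK : IsCompact K) :
    ConcaveOn ℝ (interior K) fun w => Real.log (volume (refl2 K w)).toReal := by
  refine concaveOn_iff_forall_pos.2 ⟨hc.interior, ?_⟩
  intro x hx y hy s t hs ht hst
  have h := bm_euc (refl2_closed hK x).measurableSet (refl2_closed hK y).measurableSet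
    (refl2_closed hK (s • x + t • y)).measurableSet hs ht hst (by
      rintro a ⟨ha, ha'⟩ b ⟨hb, hb'⟩
      refine ⟨hc ha hb hs.le ht.le hst, ?_⟩
      have := hc ha' hb' hs.le ht.le hst
      convert this using 1
      module)
  have px := ENNReal.toReal_pos (refl2_pos hx).ne' (refl2_ne_top hK x)
  have py := ENNReal.toReal_pos (refl2_pos hy).ne' (refl2_ne_top hK y)
  have h' := ENNReal.toReal_mono (refl2_ne_top hK _) h
  rw [ENNReal.toReal_mul, ← ENNReal.toReal_rpow, ← ENNReal.toReal_rpow] at h'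
  have h2 := Real.log_le_log (by positivity) h'
  rw [Real.log_mul (by positivity) (by positivity), Real.log_rpow px, Real.log_rpow py] at h2
  simpa using h2

lemma refl2_integral {K : Set (Euc n)} (hK : IsCompact K)
    (hcen : (∫ x in K, x) = (0 : Euc n)) (α : ℝ) (L : Euc n →L[ℝ] ℝ) :
    Integrable (fun w => (α + L w) * (volume (refl2 K w)).toReal) ∧
    ∫ w, (α + L w) * (volume (refl2 K w)).toReal = ((2:ℝ)^n)⁻¹ * (volume K).toReal ^ 2 * α := by
  let P : Set (Euc n × Euc n) := {p | p.2 ∈ K ∧ (2:ℝ) • p.1 - p.2 ∈ K}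
  have hP : IsCompact P := by
    have : P = (fun q : Euc n × Euc n => ((1/2:ℝ) • (q.1 + q.2), q.1)) '' (K ×ˢ K) := by
      ext ⟨w, x⟩
      constructor
      · rintro ⟨h1, h2⟩
        refine ⟨(x, (2:ℝ) • w - x), ⟨h1, h2⟩, ?_⟩
        simp [smul_smul]
      · rintro ⟨⟨a, b⟩, ⟨h1, h2⟩, h3⟩
        simp only [Prod.mk.injEq] at h3
        obtain ⟨rfl, rfl⟩ := h3
        refine ⟨h1, ?_⟩
        simpa [smul_smul] using h2
    rw [this]
    exact (hK.prod hK).image (by fun_prop)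
  let F : Euc n → Euc n → ℝ := fun w x => P.indicator (fun p => α + L p.1) (w, x)
  have hF : Integrable (Function.uncurry F) (volume.prod volume) := by
    have : IntegrableOn (fun p : Euc n × Euc n => α + L p.1) P (volume.prod volume) :=
      (by fun_prop : Continuous fun p : Euc n × Euc n => α + L p.1).continuousOn.integrableOn_compact hP
    exact (integrable_indicator_iff hP.measurableSet).2 this
  have e1 : ∀ w, ∫ x, F w x = (α + L w) * (volume (refl2 K w)).toReal := by
    intro w
    have : ∀ x, F w x = (refl2 K w).indicator (fun _ => α + L w) x := by
      intro x
      by_cases h : x ∈ K ∧ (2:ℝ) • w - x ∈ K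
      · rw [indicator_of_mem (s := refl2 K w) h]
        exact indicator_of_mem (s := P) h _
      · rw [indicator_of_notMem (s := refl2 K w) h]
        exact indicator_of_notMem (s := P) h _
    simp_rw [this]
    rw [integral_indicator (refl2_closed hK w).measurableSet, setIntegral_const, smul_eq_mul, mul_comm]
    rfl
  have hint : IntegrableOn (fun x : Euc n => x) K := continuousOn_id.integrableOn_compact hK
  have hL : IntegrableOn (fun x : Euc n => L x) K := L.continuous.continuousOn.integrableOn_compact hK
  have hL0 : ∫ x in K, L x = 0 := by
    rw [L.integral_comp_comm hint, hcen, map_zero]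
  have hcst : ∀ c : ℝ, IntegrableOn (fun _ : Euc n => c) K := fun c =>
    continuousOn_const.integrableOn_compact hK
  have e2 : ∀ x, ∫ w, F w x = K.indicator (fun x => ((2:ℝ)^n)⁻¹ * (volume K).toReal * (α + L x / 2)) x := by
    intro x
    by_cases hx : x ∈ K
    · have h1 : ∀ w, F w x = (fun z => K.indicator (fun y => α + L x / 2 + L y / 2) (z - x)) ((2:ℝ) • w) := by
        intro w
        by_cases h : (2:ℝ) • w - x ∈ K
        · have e : F w x = α + L w := indicator_of_mem (s := P) (show x ∈ K ∧ _ from ⟨hx, h⟩) _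
          simp only [e, indicator_of_mem h, map_sub, map_smul, smul_eq_mul]
          ring
        · have e : F w x = 0 := indicator_of_notMem (s := P) (fun h' => h h'.2) _
          simp only [e, indicator_of_notMem h]
      simp_rw [h1]
      rw [Measure.integral_comp_smul volume (fun z => K.indicator (fun y => α + L x / 2 + L y / 2) (z - x)),
        integral_sub_right_eq_self, integral_indicator hK.measurableSet,
        integral_add (hcst _) (hL.div_const 2), setIntegral_const, integral_div, hL0]
      simp [hx, Measure.real]
      ring
    · simp [F, P, hx]
  have hint2 := hF.integral_prod_left
  simp only [Function.uncurry] at hint2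
  simp_rw [e1] at hint2
  refine ⟨hint2, ?_⟩
  have sw := integral_integral_swap hF
  simp_rw [e1, e2] at sw
  rw [sw, integral_indicator hK.measurableSet, integral_const_mul,
    integral_add (hcst _) (hL.div_const 2), setIntegral_const, integral_div, hL0]
  simp [Measure.real]
  ring

lemma milman_pajor {K : Set (Euc n)} (hc : Convex ℝ K) (hK : IsCompact K)
    (hi : (interior K).Nonempty) (hcen : (∫ x in K, x) = (0 : Euc n)) :
    ((2:ℝ)^n)⁻¹ * (volume K).toReal ≤ (volume (K ∩ -K)).toReal := by
  have h0 := zero_mem_interior hc hK hi hcen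
  obtain ⟨L, hL⟩ := supergrad isOpen_interior (refl2_logconcave hc hK) h0
  set V := (volume K).toReal with hV
  have hVpos : 0 < V := ENNReal.toReal_pos
    ((isOpen_interior.measure_pos volume hi).trans_le (measure_mono interior_subset)).ne'
    hK.measure_ne_top
  set f : Euc n → ℝ := fun w => (volume (refl2 K w)).toReal with hf
  have hf0 : f 0 = (volume (K ∩ -K)).toReal := by
    simp only [hf, refl2]; congr 2; ext x; simp
  rw [← hf0]
  have hfpos : ∀ w ∈ interior K, 0 < f w := fun w hw =>
    ENNReal.toReal_pos (refl2_pos hw).ne' (refl2_ne_top hK w)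
  set c := ((2:ℝ)^n)⁻¹ * V with hcdef
  have hcpos : 0 < c := by positivity
  obtain ⟨i1, i2⟩ := refl2_integral hK hcen (Real.log c + 1 - Real.log (f 0)) (-L)
  have hle : ∫ w, (Real.log c + 1 - Real.log (f 0) + (-L) w) * f w ≤ ∫ w, K.indicator (fun _ => c) w := by
    apply integral_mono_ae i1
    · exact (integrable_indicator_iff hK.measurableSet).2 (continuousOn_const.integrableOn_compact hK)
    · have : ∀ᵐ w ∂(volume : Measure (Euc n)), w ∉ frontier K :=
        measure_eq_zero_iff_ae_notMem.1 (hc.addHaar_frontier volume)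
      filter_upwards [this] with w hw
      by_cases hwK : w ∈ K
      · have hwi : w ∈ interior K := by
          by_contra h
          exact hw ⟨subset_closure hwK, h⟩
        have h1 := hL w hwi
        have h2 := Real.one_sub_inv_le_log_of_pos (div_pos (hfpos w hwi) hcpos)
        rw [Real.log_div (hfpos w hwi).ne' hcpos.ne', inv_div] at h2
        change Real.log (f w) ≤ Real.log (f 0) + L w at h1
        rw [indicator_of_mem hwK]
        have h3 : Real.log c + 1 - Real.log (f 0) + (-L) w ≤ c / f w := by
          simp only [neg_apply]; linarith
        exact (le_div_iff₀ (hfpos w hwi)).1 h3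
      · have : refl2 K w = ∅ := by
          ext x
          simp only [refl2, mem_ofPred_eq, mem_empty_iff_false, iff_false, not_and]
          intro hx hx'
          apply hwK
          have := hc hx hx' (by norm_num : (0:ℝ) ≤ 1/2) (by norm_num : (0:ℝ) ≤ 1/2) (by norm_num)
          convert this using 1
          module
        simp [hf, this, hwK]
  rw [i2, integral_indicator hK.measurableSet, setIntegral_const, smul_eq_mul] at hle
  change ((2:ℝ)^n)⁻¹ * V ^ 2 * _ ≤ V * c at hle
  have h5 : (V * c) * (Real.log c + 1 - Real.log (f 0)) ≤ (V * c) * 1 := by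
    calc _ = ((2:ℝ)^n)⁻¹ * V ^ 2 * (Real.log c + 1 - Real.log (f 0)) := by rw [hcdef]; ring
      _ ≤ _ := by simpa using hle
  have h6 := le_of_mul_le_mul_left h5 (by positivity)
  exact (Real.log_le_log_iff hcpos (hfpos 0 h0)).1 (by linarith)

/-- saturation of `S` under translations by `Γ` in the first coordinate -/
def sat {E F : Type*} [AddCommGroup E] (Γ : Submodule ℤ E) (S : Set (E × F)) : Set (E × F) :=
  {p | ∃ γ ∈ Γ, (p.1 + γ, p.2) ∈ S}

lemma sat_open {E F : Type*} [AddCommGroup E] [TopologicalSpace E] [TopologicalSpace F]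
    [ContinuousAdd E] (Γ : Submodule ℤ E) {S : Set (E × F)} (hS : IsOpen S) : IsOpen (sat Γ S) := by
  have : sat Γ S = ⋃ γ ∈ Γ, (fun p : E × F => (p.1 + γ, p.2)) ⁻¹' S := by
    ext p; simp [sat]
  rw [this]
  exact isOpen_biUnion fun γ _ => hS.preimage (by fun_prop)

lemma fiber_step {E F : Type*} [NormedAddCommGroup E] [NormedSpace ℝ E] [MeasurableSpace E]
    [BorelSpace E] [FiniteDimensional ℝ E] [NormedAddCommGroup F] [NormedSpace ℝ F]
    (μ : Measure E) [μ.IsAddHaarMeasure] (Γ : Submodule ℤ E) [Countable Γ] {D : Set E}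
    (hD : IsAddFundamentalDomain Γ D μ) {S : Set (E × F)} (hS : IsOpen S) (hc : Convex ℝ S)
    {r : ℝ} (hr : 1 ≤ r) (y : F) :
    μ ({x | (x, y) ∈ sat Γ S} ∩ D) ≤ μ ({x | (x, r • y) ∈ sat Γ (r • S)} ∩ D) := by
  set B : Set E := {x | (x, y) ∈ sat Γ S} with hB
  set B' : Set E := {x | (x, r • y) ∈ sat Γ (r • S)} with hB'
  rcases B.eq_empty_or_nonempty with h0 | ⟨x0, γ0, hγ0, h0⟩
  · simp [h0]
  set a : E := x0 + γ0 with ha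
  set c : E := (r - 1) • a with hcdef
  have hr0 : 0 < r := by linarith
  have hBopen : IsOpen B := (sat_open Γ hS).preimage (by fun_prop : Continuous fun x : E => (x, y))
  have hsub : c +ᵥ B ⊆ B' := by
    rintro _ ⟨x, ⟨γ, hγ, hx⟩, rfl⟩
    refine ⟨γ, hγ, ?_⟩
    rw [mem_smul_set]
    refine ⟨(1/r) • (x + γ, y) + (1 - 1/r) • (a, y), hc hx h0 (by positivity) ?_ (by ring), ?_⟩
    · rw [sub_nonneg, div_le_one hr0]; exact hr
    · have e1 : r • ((1/r) • (x + γ, y) + (1 - 1/r) • (a, y)) = (x + γ, y) + (r - 1) • (a, y) := by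
        rw [smul_add, smul_smul, smul_smul, mul_sub, mul_one_div_cancel hr0.ne', one_smul, mul_one]
      rw [e1]
      simp only [Prod.smul_mk, Prod.mk_add_mk, vadd_eq_add, Prod.mk.injEq]
      constructor
      · rw [hcdef]; abel
      · module
  have h1 : μ (B ∩ D) = μ ((c +ᵥ B) ∩ (c +ᵥ D)) := by
    rw [← vadd_set_inter, measure_vadd]
  have hinv : ∀ g : Γ, (fun x => g +ᵥ x) ⁻¹' (c +ᵥ B) = c +ᵥ B := by
    intro g
    ext x
    simp only [mem_preimage, mem_vadd_set_iff_neg_vadd_mem]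
    constructor
    · rintro ⟨γ, hγ, h⟩
      refine ⟨γ + g, Γ.add_mem hγ g.2, ?_⟩
      convert h using 2
      simp only [vadd_eq_add, Submodule.vadd_def]; abel
    · rintro ⟨γ, hγ, h⟩
      refine ⟨γ - g, Γ.sub_mem hγ g.2, ?_⟩
      convert h using 2
      simp only [vadd_eq_add, Submodule.vadd_def]; abel
  have : VAddInvariantMeasure Γ E μ := inferInstanceAs (VAddInvariantMeasure Γ.toAddSubgroup E μ)
  have : MeasurableConstVAdd Γ E := inferInstanceAs (MeasurableConstVAdd Γ.toAddSubgroup E)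
  have : VAddCommClass E Γ E := ⟨fun a b x => by
    simp only [vadd_eq_add, Submodule.vadd_def]; abel⟩
  have h2 : μ ((c +ᵥ B) ∩ D) = μ ((c +ᵥ B) ∩ (c +ᵥ D)) :=
    hD.measure_set_eq (hD.vadd_of_comm c) (hBopen.vadd c).measurableSet hinv
  rw [h1, ← h2]
  exact measure_mono (inter_subset_inter_left _ hsub)

lemma prod_step {E F : Type*} [NormedAddCommGroup E] [NormedSpace ℝ E] [MeasurableSpace E]
    [BorelSpace E] [FiniteDimensional ℝ E] [NormedAddCommGroup F] [NormedSpace ℝ F]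
    [MeasurableSpace F] [BorelSpace F] [FiniteDimensional ℝ F]
    (μ : Measure E) [μ.IsAddHaarMeasure] (ν : Measure F) [ν.IsAddHaarMeasure]
    (Γ : Submodule ℤ E) [Countable Γ] {D : Set E} (hDm : MeasurableSet D)
    (hD : IsAddFundamentalDomain Γ D μ) {S : Set (E × F)} (hS : IsOpen S) (hc : Convex ℝ S)
    {r : ℝ} (hr : 1 ≤ r) :
    ENNReal.ofReal (r ^ Module.finrank ℝ F) * (μ.prod ν) (sat Γ S ∩ (Prod.fst ⁻¹' D)) ≤
      (μ.prod ν) (sat Γ (r • S) ∩ (Prod.fst ⁻¹' D)) := by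
  have hr0 : 0 < r := by linarith
  have m1 : MeasurableSet (sat Γ S ∩ (Prod.fst ⁻¹' D)) :=
    (sat_open Γ hS).measurableSet.inter (measurable_fst hDm)
  have m2 : MeasurableSet (sat Γ (r • S) ∩ (Prod.fst ⁻¹' D)) :=
    (sat_open Γ (hS.smul₀ hr0.ne')).measurableSet.inter (measurable_fst hDm)
  rw [Measure.prod_apply_symm m1, Measure.prod_apply_symm m2]
  set g : F → ℝ≥0∞ := fun y => μ ((fun x => (x, y)) ⁻¹' (sat Γ (r • S) ∩ Prod.fst ⁻¹' D)) with hg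
  have mg : Measurable g := measurable_measure_prodMk_right m2
  have h1 : ∫⁻ y, g (r • y) ∂ν = ENNReal.ofReal |(r ^ Module.finrank ℝ F)⁻¹| * ∫⁻ y, g y ∂ν := by
    rw [← lintegral_map mg (measurable_const_smul r), Measure.map_addHaar_smul ν hr0.ne',
      lintegral_smul_measure, smul_eq_mul]
  have h2 : ∫⁻ y, μ ((fun x => (x, y)) ⁻¹' (sat Γ S ∩ Prod.fst ⁻¹' D)) ∂ν ≤ ∫⁻ y, g (r • y) ∂ν :=
    lintegral_mono fun y => fiber_step μ Γ hD hS hc hr y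
  calc _ ≤ ENNReal.ofReal (r ^ Module.finrank ℝ F) * ∫⁻ y, g (r • y) ∂ν := by gcongr
    _ = ∫⁻ y, g y ∂ν := by
      rw [h1, ← mul_assoc, ← ENNReal.ofReal_mul (by positivity), abs_of_pos (by positivity),
        mul_inv_cancel₀ (by positivity)]
      simp

/-- volume of the image of `S` in `ℝ^n / Λ` -/
def Q (Λ : Submodule ℤ (Euc n)) (D S : Set (Euc n)) : ℝ≥0∞ :=
  volume ({x | ∃ γ ∈ Λ, x + γ ∈ S} ∩ D)

lemma Q_of_inj (Λ : Submodule ℤ (Euc n)) [Countable Λ] {D : Set (Euc n)} (hDm : MeasurableSet D)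
    (hD : IsAddFundamentalDomain Λ D volume) {S : Set (Euc n)} (hS : MeasurableSet S)
    (hinj : ∀ x ∈ S, ∀ y ∈ S, x - y ∈ Λ → x = y) : volume S = Q Λ D S := by
  have : VAddInvariantMeasure Λ (Euc n) volume :=
    inferInstanceAs (VAddInvariantMeasure Λ.toAddSubgroup (Euc n) volume)
  have : MeasurableConstVAdd Λ (Euc n) := inferInstanceAs (MeasurableConstVAdd Λ.toAddSubgroup (Euc n))
  rw [hD.measure_eq_tsum S, ← measure_iUnion]
  · rw [Q]
    congr 1
    ext x
    simp only [mem_iUnion, mem_inter_iff, mem_vadd_set_iff_neg_vadd_mem, mem_ofPred_eq]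
    constructor
    · rintro ⟨g, hg, hx⟩
      refine ⟨⟨-g, Λ.neg_mem g.2, ?_⟩, hx⟩
      simpa [Submodule.vadd_def, add_comm] using hg
    · rintro ⟨⟨γ, hγ, h⟩, hx⟩
      refine ⟨-⟨γ, hγ⟩, ?_, hx⟩
      simpa [Submodule.vadd_def, add_comm] using h
  · intro g g' hgg
    rw [Function.onFun, Set.disjoint_left]
    rintro x ⟨⟨a, ha, hax⟩, _⟩ ⟨⟨b, hb, hbx⟩, _⟩
    apply hgg
    simp only [Submodule.vadd_def, vadd_eq_add] at hax hbx
    have hab : a - b = g' - g := by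
      have : (g : Euc n) + a = g' + b := hax.trans hbx.symm
      rw [sub_eq_sub_iff_add_eq_add, add_comm, this]
    have := hinj a ha b hb (by rw [hab]; exact Λ.sub_mem g'.2 g.2)
    rw [this, sub_self] at hab
    exact Subtype.ext (sub_eq_zero.1 hab.symm).symm
  · intro g
    exact (hS.const_vadd g).inter hDm


lemma exists_fd {E : Type*} [NormedAddCommGroup E] [NormedSpace ℝ E] [MeasurableSpace E]
    [BorelSpace E] [FiniteDimensional ℝ E] (μ : Measure E) (Γ : Submodule ℤ E)
    [DiscreteTopology Γ] [IsZLattice ℝ Γ] :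
    ∃ D0 : Set E, MeasurableSet D0 ∧ IsAddFundamentalDomain Γ D0 μ ∧
      (∀ x, ∃ γ ∈ Γ, x + γ ∈ D0) ∧ (∀ x ∈ D0, ∀ y ∈ D0, x - y ∈ Γ → x = y) := by
  have : Module.Free ℤ Γ := ZLattice.module_free ℝ Γ
  let b := Module.Free.chooseBasis ℤ Γ
  have hspan : Submodule.span ℤ (range (b.ofZLatticeBasis ℝ)) = Γ := b.ofZLatticeBasis_span ℝ
  refine ⟨ZSpan.fundamentalDomain (b.ofZLatticeBasis ℝ), ZSpan.fundamentalDomain_measurableSet _,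
    ZLattice.isAddFundamentalDomain b μ, ?_, ?_⟩
  · intro x
    obtain ⟨γ, hγ, _⟩ := ZSpan.exist_unique_vadd_mem_fundamentalDomain (b.ofZLatticeBasis ℝ) x
    refine ⟨γ, (SetLike.ext_iff.1 hspan _).1 γ.2, ?_⟩
    have h : (γ : E) + x ∈ ZSpan.fundamentalDomain (b.ofZLatticeBasis ℝ) := hγ
    rwa [add_comm] at h
  · intro x hx y hy hxy
    have hx' := (ZSpan.fract_eq_self (b := b.ofZLatticeBasis ℝ)).2 hx
    have hy' := (ZSpan.fract_eq_self (b := b.ofZLatticeBasis ℝ)).2 hy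
    rw [← hx', ← hy', ZSpan.fract_eq_fract]
    apply (SetLike.ext_iff.1 hspan _).2
    have := Γ.neg_mem hxy
    rwa [neg_sub, sub_eq_neg_add] at this

lemma key_abs {E F : Type*} [NormedAddCommGroup E] [NormedSpace ℝ E] [MeasurableSpace E]
    [BorelSpace E] [FiniteDimensional ℝ E] [NormedAddCommGroup F] [NormedSpace ℝ F]
    [MeasurableSpace F] [BorelSpace F] [FiniteDimensional ℝ F]
    (e : (E × F) ≃L[ℝ] Euc n) (Λ : Submodule ℤ (Euc n)) [Countable Λ]
    {D : Set (Euc n)} (hDm : MeasurableSet D)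
    (hD : IsAddFundamentalDomain Λ D volume) (Γ : Submodule ℤ E)
    (hΓ : ∀ x, x ∈ Γ ↔ e (x, 0) ∈ Λ) {D0 : Set E} (hD0m : MeasurableSet D0)
    (hex : ∀ x, ∃ γ ∈ Γ, x + γ ∈ D0) (huniq : ∀ x ∈ D0, ∀ y ∈ D0, x - y ∈ Γ → x = y)
    {T : Set (Euc n)} (hT : IsOpen T)
    (hTV : ∀ x ∈ T, ∀ y ∈ T, x - y ∈ Λ → (e.symm (x - y)).2 = 0) :
    volume (e.symm ⁻¹' (sat Γ (e ⁻¹' T) ∩ Prod.fst ⁻¹' D0)) = Q Λ D T := by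
  have hsh : ∀ (p : E × F) (δ : E), e (p.1 + δ, p.2) = e p + e (δ, 0) := by
    intro p δ
    rw [← map_add]; congr 1; ext <;> simp
  have hsh' : ∀ (x : Euc n) (δ : E), e.symm (x + e (δ, 0)) = ((e.symm x).1 + δ, (e.symm x).2) := by
    intro x δ
    rw [e.symm_apply_eq, hsh, e.apply_symm_apply]
  have hS0m : MeasurableSet (e.symm ⁻¹' (sat Γ (e ⁻¹' T) ∩ Prod.fst ⁻¹' D0)) := by
    apply e.symm.continuous.measurable
    exact (sat_open Γ (hT.preimage e.continuous)).measurableSet.inter (measurable_fst hD0m)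
  rw [Q_of_inj Λ hDm hD hS0m]
  · rw [Q, Q]
    congr 2
    ext x
    constructor
    · rintro ⟨γ, hγ, ⟨⟨δ, hδ, hx⟩, _⟩⟩
      refine ⟨γ + e (δ, 0), Λ.add_mem hγ ((hΓ δ).1 hδ), ?_⟩
      rw [mem_preimage, hsh, e.apply_symm_apply] at hx
      rwa [← add_assoc]
    · rintro ⟨γ, hγ, hx⟩
      obtain ⟨δ, hδ, hδ'⟩ := hex (e.symm (x + γ)).1
      refine ⟨γ + e (δ, 0), Λ.add_mem hγ ((hΓ δ).1 hδ), ?_⟩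
      rw [← add_assoc, mem_preimage, hsh']
      refine ⟨⟨-δ, Γ.neg_mem hδ, ?_⟩, hδ'⟩
      rw [mem_preimage, add_neg_cancel_right, Prod.mk.eta, e.apply_symm_apply]
      exact hx
  · rintro x ⟨⟨γ, hγ, hx⟩, hx'⟩ y ⟨⟨δ, hδ, hy⟩, hy'⟩ hxy
    rw [mem_preimage, hsh, e.apply_symm_apply] at hx hy
    have e0 : x + e (γ, 0) - (y + e (δ, 0)) = (x - y) + e (γ - δ, 0) := by
      have : ((γ - δ, 0) : E × F) = (γ, 0) - (δ, 0) := by ext <;> simp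
      rw [this, map_sub]; abel
    have hd := hTV _ hx _ hy (by
      rw [e0]; exact Λ.add_mem hxy ((hΓ _).1 (Γ.sub_mem hγ hδ)))
    rw [e0, hsh', map_sub] at hd
    have hd' : (e.symm x).2 = (e.symm y).2 := by
      simpa [sub_eq_zero] using hd
    have e5 := huniq _ hx' _ hy' (by
      rw [hΓ]
      convert hxy using 1
      rw [← e.eq_symm_apply, map_sub]
      ext
      · simp
      · simp [hd'])
    apply e.symm.injective
    exact Prod.ext e5 hd'

lemma global_abs {E F : Type*} [NormedAddCommGroup E] [NormedSpace ℝ E] [MeasurableSpace E]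
    [BorelSpace E] [FiniteDimensional ℝ E] [NormedAddCommGroup F] [NormedSpace ℝ F]
    [MeasurableSpace F] [BorelSpace F] [FiniteDimensional ℝ F]
    (μ : Measure E) [μ.IsAddHaarMeasure] (ν : Measure F) [ν.IsAddHaarMeasure]
    (e : (E × F) ≃L[ℝ] Euc n) (Λ : Submodule ℤ (Euc n)) [Countable Λ]
    {D : Set (Euc n)} (hDm : MeasurableSet D)
    (hD : IsAddFundamentalDomain Λ D volume) (Γ : Submodule ℤ E)
    [DiscreteTopology Γ] [IsZLattice ℝ Γ]
    (hΓ : ∀ x, x ∈ Γ ↔ e (x, 0) ∈ Λ)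
    {S : Set (Euc n)} (hS : IsOpen S) (hc : Convex ℝ S) {r : ℝ} (hr : 1 ≤ r)
    (h1 : ∀ x ∈ S, ∀ y ∈ S, x - y ∈ Λ → (e.symm (x - y)).2 = 0)
    (h2 : ∀ x ∈ r • S, ∀ y ∈ r • S, x - y ∈ Λ → (e.symm (x - y)).2 = 0) :
    ENNReal.ofReal (r ^ Module.finrank ℝ F) * Q Λ D S ≤ Q Λ D (r • S) := by
  have hr0 : 0 < r := by linarith
  obtain ⟨D0, hD0m, hD0, hex, huniq⟩ := exists_fd μ Γ
  have : Countable Γ := inferInstance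
  have hvol : ∃ c : ℝ≥0∞, ∀ X, volume (e.symm ⁻¹' X) = c * (μ.prod ν) X := by
    have := e.isAddHaarMeasure_map (μ.prod ν)
    refine ⟨(Measure.addHaarScalarFactor (volume : Measure (Euc n)) (Measure.map e (μ.prod ν)) : ℝ≥0∞), ?_⟩
    intro X
    conv_lhs => rw [Measure.isAddLeftInvariant_eq_smul (volume : Measure (Euc n)) (Measure.map e (μ.prod ν))]
    rw [Measure.smul_apply]
    have h := e.toHomeomorph.toMeasurableEquiv.map_apply (μ := μ.prod ν) (e.symm ⁻¹' X)
    have h2 : (e.toHomeomorph.toMeasurableEquiv : E × F → Euc n) ⁻¹' (e.symm ⁻¹' X) = X := by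
      ext p; simp
    rw [h2] at h
    rw [← h]
    rfl
  obtain ⟨c, hvol⟩ := hvol
  rw [← key_abs e Λ hDm hD Γ hΓ hD0m hex huniq hS h1,
    ← key_abs e Λ hDm hD Γ hΓ hD0m hex huniq (hS.smul₀ hr0.ne') h2, hvol, hvol]
  have hpre : e ⁻¹' (r • S) = r • (e ⁻¹' S) := by
    ext p
    rw [mem_preimage, mem_smul_set_iff_inv_smul_mem₀ hr0.ne', mem_smul_set_iff_inv_smul_mem₀ hr0.ne',
      mem_preimage, map_smul]
  rw [hpre, mul_left_comm]
  gcongr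
  exact prod_step μ ν Γ hD0m hD0 (hS.preimage e.continuous)
    (hc.linear_preimage e.toLinearMap) hr

lemma comap_isZ (Λ : Submodule ℤ (Euc n)) (V : Submodule ℝ (Euc n))
    (hV : V ≤ Submodule.span ℝ ((Λ : Set (Euc n)) ∩ V)) :
    Submodule.span ℝ (ZLattice.comap ℝ Λ V.subtype : Set V) = ⊤ := by
  have e : (ZLattice.comap ℝ Λ V.subtype : Set V) = V.subtype ⁻¹' ((Λ : Set (Euc n)) ∩ V) := by
    ext x; simp
  have hne : ((Λ : Set (Euc n)) ∩ V).Nonempty := ⟨0, Λ.zero_mem, V.zero_mem⟩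
  have hsub : ((Λ : Set (Euc n)) ∩ V) ⊆ LinearMap.range V.subtype := by
    intro x hx; simpa using hx.2
  have h := Submodule.span_preimage_eq (f := V.subtype) hne hsub
  rw [e, h, eq_top_iff]
  intro x _
  exact hV x.2

lemma global_step (Λ : Submodule ℤ (Euc n)) [DiscreteTopology Λ] [IsZLattice ℝ Λ]
    {D : Set (Euc n)} (hDm : MeasurableSet D)
    (hD : IsAddFundamentalDomain Λ D volume) (V : Submodule ℝ (Euc n))
    (hV : V ≤ Submodule.span ℝ ((Λ : Set (Euc n)) ∩ V)) {S : Set (Euc n)} (hS : IsOpen S)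
    (hc : Convex ℝ S) {r : ℝ} (hr : 1 ≤ r)
    (h1 : ∀ x ∈ S, ∀ y ∈ S, x - y ∈ Λ → x - y ∈ V)
    (h2 : ∀ x ∈ r • S, ∀ y ∈ r • S, x - y ∈ Λ → x - y ∈ V) :
    ENNReal.ofReal (r ^ (n - Module.finrank ℝ V)) * Q Λ D S ≤ Q Λ D (r • S) := by
  have : DiscreteTopology (ZLattice.comap ℝ Λ V.subtype) :=
    ZLattice.comap_discreteTopology ℝ Λ continuous_subtype_val Subtype.val_injective
  have : IsZLattice ℝ (ZLattice.comap ℝ Λ V.subtype) := ⟨comap_isZ Λ V hV⟩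
  have : Countable Λ := inferInstance
  obtain ⟨e, he⟩ : ∃ e : (V × Vᗮ) ≃L[ℝ] Euc n, ∀ p : V × Vᗮ, e p = p.1 + p.2 :=
    ⟨(Submodule.prodEquivOfIsCompl V Vᗮ V.isCompl_orthogonal).toContinuousLinearEquiv, fun p => rfl⟩
  have hfr : Module.finrank ℝ Vᗮ = n - Module.finrank ℝ V := by
    have := Submodule.finrank_add_finrank_orthogonal V
    rw [finrank_euclideanSpace_fin] at this
    omega
  have h0 : ∀ x ∈ V, (e.symm x).2 = 0 := by
    intro x hx
    have : e.symm x = (⟨x, hx⟩, 0) := by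
      rw [e.symm_apply_eq, he]; simp
    rw [this]
  rw [← hfr]
  refine global_abs volume volume e Λ hDm hD (ZLattice.comap ℝ Λ V.subtype) ?_ hS hc hr
    (fun x hx y hy h => h0 _ (h1 x hx y hy h)) (fun x hx y hy h => h0 _ (h2 x hx y hy h))
  intro x
  rw [he, ZeroMemClass.coe_zero, add_zero]
  exact Iff.rfl

lemma finrank_span_le_of (A : Set (Euc n)) (k : ℕ)
    (h : ∀ v : Fin (k+1) → Euc n, LinearIndependent ℝ v → ¬ ∀ j, v j ∈ A) :
    Module.finrank ℝ (Submodule.span ℝ A) ≤ k := by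
  by_contra hk
  push Not at hk
  obtain ⟨f, hf, hs, hli⟩ := Submodule.exists_fun_fin_finrank_span_eq ℝ A
  have hle : k + 1 ≤ Module.finrank ℝ (Submodule.span ℝ A) := hk
  exact h (f ∘ Fin.castLE hle) (hli.comp _ (Fin.castLE_injective hle)) (fun j => hf _)

lemma mink2 (Λ : Submodule ℤ (Euc n)) [DiscreteTopology Λ] [IsZLattice ℝ Λ]
    {D : Set (Euc n)} (hDm : MeasurableSet D)
    (hD : IsAddFundamentalDomain Λ D volume) (hn : 0 < n) {C : Set (Euc n)} (hCo : IsOpen C)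
    (hCc : Convex ℝ C) (hsym : ∀ x ∈ C, -x ∈ C) (h0 : (0 : Euc n) ∈ C) (l : ℕ → ℝ)
    (hpos : ∀ i < n, 0 < l i) (hmono : ∀ i, i + 1 < n → l i ≤ l (i+1))
    (hl : ∀ i < n, ∀ v : Fin (i+1) → Euc n, LinearIndependent ℝ v →
      ¬ ∀ j, v j ∈ (Λ : Set (Euc n)) ∩ (l i • C)) :
    ENNReal.ofReal (∏ i ∈ Finset.range n, l i) * volume ((1/2 : ℝ) • C) ≤ volume D := by
  set M := (1/2 : ℝ) • C with hM
  have hMo : IsOpen M := hCo.smul₀ (by norm_num)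
  have hMc : Convex ℝ M := hCc.smul _
  have hdiff : ∀ t : ℝ, ∀ x ∈ t • M, ∀ y ∈ t • M, x - y ∈ t • C := by
    rintro t _ ⟨_, ⟨a, ha, rfl⟩, rfl⟩ _ ⟨_, ⟨c, hc, rfl⟩, rfl⟩
    refine ⟨(1/2 : ℝ) • a + (1/2 : ℝ) • (-c), hCc ha (hsym c hc) (by norm_num) (by norm_num) (by norm_num), ?_⟩
    simp only
    module
  have hCmono : ∀ s t : ℝ, 0 < s → s ≤ t → s • C ⊆ t • C := by
    rintro s t hs hst _ ⟨a, ha, rfl⟩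
    have ht : 0 < t := hs.trans_le hst
    refine ⟨(s/t) • a, ?_, ?_⟩
    · exact hCc.smul_mem_of_zero_mem h0 ha ⟨by positivity, (div_le_one ht).2 hst⟩
    · simp only [smul_smul]
      rw [mul_div_cancel₀ _ ht.ne']
  have main : ∀ k < n, ENNReal.ofReal ((∏ i ∈ Finset.range (k+1), l i) * l k ^ (n - 1 - k)) * volume M
      ≤ Q Λ D (l k • M) := by
    intro k
    induction k with
    | zero =>
      intro _
      have hl0 := hpos 0 hn
      rw [← Q_of_inj Λ hDm hD (hMo.smul₀ hl0.ne').measurableSet]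
      · rw [Measure.addHaar_smul volume (l 0) M, finrank_euclideanSpace_fin, abs_of_pos (by positivity)]
        simp only [zero_add, Finset.prod_range_one, tsub_zero]
        rw [← pow_succ', Nat.sub_add_cancel hn]
      · intro x hx y hy hxy
        by_contra hne
        apply hl 0 hn (fun _ => x - y)
        · have : Unique (Fin (0+1)) := inferInstanceAs (Unique (Fin 1))
          rw [linearIndependent_unique_iff]
          exact sub_ne_zero.2 hne
        · intro _
          exact ⟨hxy, hdiff _ x hx y hy⟩
    | succ k ih =>
      intro hk
      have ih := ih (by omega)
      have hlk := hpos k (by omega)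
      have hlk1 := hpos (k+1) hk
      have hm := hmono k hk
      have hr : 1 ≤ l (k+1) / l k := (one_le_div hlk).2 hm
      set r := l (k+1) / l k with hrdef
      have hrl : r * l k = l (k+1) := div_mul_cancel₀ _ hlk.ne'
      set A : Set (Euc n) := (Λ : Set (Euc n)) ∩ (l (k+1) • C) with hA
      have hfin := finrank_span_le_of A (k+1) (hl (k+1) hk)
      have hrS : r • (l k • M) = l (k+1) • M := by rw [smul_smul, hrl]
      have hg := global_step Λ hDm hD (Submodule.span ℝ A)
        (Submodule.span_mono fun x hx => ⟨hx.1, Submodule.subset_span hx⟩)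
        (hMo.smul₀ hlk.ne') (hMc.smul _) hr
        (fun x hx y hy h => Submodule.subset_span ⟨h, hCmono _ _ hlk hm (hdiff _ x hx y hy)⟩)
        (by
          rw [hrS]
          exact fun x hx y hy h => Submodule.subset_span ⟨h, hdiff _ x hx y hy⟩)
      rw [hrS] at hg
      refine le_trans ?_ hg
      refine le_trans ?_ (mul_le_mul_right ih _)
      rw [← mul_assoc, ← ENNReal.ofReal_mul (by positivity)]
      refine mul_le_mul_left (ENNReal.ofReal_le_ofReal ?_) _
      have hP : 0 ≤ ∏ i ∈ Finset.range (k+1), l i :=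
        Finset.prod_nonneg fun i hi => (hpos i (by have := Finset.mem_range.1 hi; omega)).le
      obtain ⟨m, hm'⟩ : ∃ m, n = k + 2 + m := ⟨n - (k+2), by omega⟩
      have hx1 : n - 1 - (k+1) = m := by omega
      have hx2 : n - 1 - k = m + 1 := by omega
      have hpw : r ^ (m+1) ≤ r ^ (n - Module.finrank ℝ (Submodule.span ℝ A)) :=
        pow_le_pow_right₀ hr (by omega)
      rw [hx1, hx2, Finset.prod_range_succ _ (k+1)]
      calc (∏ i ∈ Finset.range (k+1), l i) * l (k+1) * l (k+1) ^ m
          = r ^ (m+1) * ((∏ i ∈ Finset.range (k+1), l i) * l k ^ (m+1)) := by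
            rw [← hrl]; ring
        _ ≤ _ := by gcongr
  have hlast := main (n-1) (by omega)
  rw [Nat.sub_self, pow_zero, mul_one, Nat.sub_add_cancel hn] at hlast
  exact hlast.trans (measure_mono inter_subset_right)

lemma lattice_gap (Λ : Submodule ℤ (Euc n)) [DiscreteTopology Λ] :
    ∃ δ > 0, ∀ x ∈ Λ, x ≠ 0 → δ ≤ ‖x‖ := by
  obtain ⟨δ, hδ, h⟩ := Metric.exists_ball_inter_eq_singleton_of_mem_discrete (s := (Λ : Set (Euc n)))
    (isDiscrete_iff_discreteTopology.2 ‹_›) Λ.zero_mem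
  refine ⟨δ, hδ, fun x hx hx0 => ?_⟩
  by_contra hlt
  push Not at hlt
  have : x ∈ Metric.ball (0 : Euc n) δ ∩ (Λ : Set (Euc n)) := ⟨by simpa using hlt, hx⟩
  rw [h] at this
  exact hx0 this

lemma succ_ne {K : Set (Euc n)} (h0 : (0 : Euc n) ∈ interior K) (b : Fin n → Euc n)
    (hb : LinearIndependent ℝ b) {i : ℕ} (hi : i ≤ n) :
    {t : ℝ | 0 < t ∧ ∃ v : Fin i → Euc n,
    LinearIndependent ℝ v ∧ ∀ j, v j ∈ latticeOf b ∧ v j ∈ t • K}.Nonempty := by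
  obtain ⟨ε, hε, hball⟩ := Metric.mem_nhds_iff.1 (mem_interior_iff_mem_nhds.1 h0)
  have hs : 0 < ∑ j, ‖b j‖ + 1 := by positivity
  have ht : 0 < (∑ j, ‖b j‖ + 1) / ε := by positivity
  refine ⟨(∑ j, ‖b j‖ + 1) / ε, ht, fun j => b (Fin.castLE hi j),
    hb.comp _ (Fin.castLE_injective hi), fun j => ⟨?_, ?_⟩⟩
  · refine ⟨Pi.single (Fin.castLE hi j) 1, ?_⟩
    rw [Finset.sum_eq_single (Fin.castLE hi j)]
    · simp
    · intro k _ hk; simp [hk]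
    · simp
  · rw [mem_smul_set_iff_inv_smul_mem₀ ht.ne']
    apply hball
    rw [mem_ball_zero_iff, norm_smul, norm_inv, Real.norm_of_nonneg ht.le, inv_mul_lt_iff₀ ht,
      div_mul_cancel₀ _ hε.ne']
    have := Finset.single_le_sum (f := fun j => ‖b j‖) (fun k _ => norm_nonneg _)
      (Finset.mem_univ (Fin.castLE hi j))
    linarith

lemma succ_bdd (K Λ : Set (Euc n)) (i : ℕ) : BddBelow {t : ℝ | 0 < t ∧ ∃ v : Fin i → Euc n,
    LinearIndependent ℝ v ∧ ∀ j, v j ∈ Λ ∧ v j ∈ t • K} := ⟨0, fun _ h => h.1.le⟩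

lemma succ_mono {K : Set (Euc n)} (h0 : (0 : Euc n) ∈ interior K) (b : Fin n → Euc n)
    (hb : LinearIndependent ℝ b) {i : ℕ} (hi : i + 1 ≤ n) :
    succMin K (latticeOf b) i ≤ succMin K (latticeOf b) (i+1) := by
  refine csInf_le_csInf (succ_bdd _ _ _) (succ_ne h0 b hb hi) ?_
  rintro t ⟨ht, v, hv, hv'⟩
  exact ⟨ht, v ∘ Fin.castSucc, hv.comp _ (Fin.castSucc_injective _), fun j => hv' _⟩

lemma succ_pos {K : Set (Euc n)} (hK : IsCompact K) (h0 : (0 : Euc n) ∈ interior K) (b : Fin n → Euc n)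
    (hb : LinearIndependent ℝ b) (Λ : Submodule ℤ (Euc n)) [DiscreteTopology Λ]
    (hΛ : ∀ x, x ∈ latticeOf b ↔ x ∈ Λ) {i : ℕ} (hi : i + 1 ≤ n) :
    0 < succMin K (latticeOf b) (i+1) := by
  obtain ⟨δ, hδ, hgap⟩ := lattice_gap Λ
  obtain ⟨R, hR, hKR⟩ := hK.isBounded.exists_pos_norm_le
  refine lt_of_lt_of_le (by positivity : 0 < δ / R) (le_csInf (succ_ne h0 b hb hi) ?_)
  rintro t ⟨ht, v, hv, hv'⟩
  have h1 := hgap (v 0) ((hΛ _).1 (hv' 0).1) (hv.ne_zero 0)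
  obtain ⟨x, hx, hxv⟩ := (hv' 0).2
  have h2 : ‖v 0‖ = t * ‖x‖ := by
    rw [← hxv, norm_smul, Real.norm_of_nonneg ht.le]
  have h3 := hKR x hx
  rw [div_le_iff₀ hR]
  nlinarith

lemma succ_excl {K C : Set (Euc n)} (hC : IsOpen C) (hCK : C ⊆ K) (Λ : Set (Euc n)) {i : ℕ}
    (hpos : 0 < succMin K Λ i) (v : Fin i → Euc n) (hv : LinearIndependent ℝ v) :
    ¬ ∀ j, v j ∈ Λ ∩ (succMin K Λ i • C) := by
  intro h
  set t := succMin K Λ i with ht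
  have hev : ∀ᶠ s : ℝ in nhds 1, ∀ j, s • (t⁻¹ • v j) ∈ C := by
    rw [eventually_all]
    intro j
    have hc : Continuous fun s : ℝ => s • (t⁻¹ • v j) := by fun_prop
    apply hc.continuousAt.eventually_mem
    apply hC.mem_nhds
    rw [one_smul]
    exact (mem_smul_set_iff_inv_smul_mem₀ hpos.ne' _ _).1 (h j).2
  obtain ⟨ε, hε, hε'⟩ := Metric.eventually_nhds_iff.1 hev
  have hs : ∀ j, (1 + ε/2) • (t⁻¹ • v j) ∈ C := hε' (by
    rw [Real.dist_eq, add_sub_cancel_left, abs_of_pos (by positivity)]; linarith)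
  have hs0 : 0 < 1 + ε/2 := by positivity
  have hle : t ≤ t / (1 + ε/2) := by
    conv_lhs => rw [ht]
    refine csInf_le (succ_bdd _ _ _) ⟨by positivity, v, hv, fun j => ⟨(h j).1, ?_⟩⟩
    rw [mem_smul_set_iff_inv_smul_mem₀ (by positivity)]
    convert hCK (hs j) using 1
    rw [smul_smul, inv_div]; rfl
  have : t / (1 + ε/2) < t := div_lt_self hpos (by linarith)
  linarith

lemma vol_fd (b : Module.Basis (Fin n) ℝ (Euc n)) :
    volume (ZSpan.fundamentalDomain b) = ENNReal.ofReal (latticeDet b) := by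
  rw [ZSpan.measure_fundamentalDomain b volume (EuclideanSpace.basisFun (Fin n) ℝ).toBasis,
    measure_congr (ZSpan.fundamentalDomain_ae_parallelepiped _ volume)]
  rw [OrthonormalBasis.coe_toBasis, OrthonormalBasis.volume_parallelepiped, mul_one, latticeDet,
    Module.Basis.det_apply]
  congr 3

lemma interior_neg_euc (A : Set (Euc n)) : interior (-A) = -interior A :=
  ((Homeomorph.neg (Euc n)).preimage_interior A).symm

/-- **Milman–Pajor/Ehrhart-type upper bound:**
`vol(K)/det Λ ≤ 4^n ∏ 1/λ_i(K,Λ)` for centred convex bodies. -/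
theorem statement17 {n : ℕ} (hn : 0 < n) (K : Set (Euc n))
    (hK : IsConvexBody K) (hcen : CentroidAtOrigin K)
    (b : Fin n → Euc n) (hb : LinearIndependent ℝ b) :
    (volume K).toReal / latticeDet b ≤
      (4 : ℝ) ^ n * ∏ i : Fin n, (succMin K (latticeOf b) ((i : ℕ) + 1))⁻¹ := by
  obtain ⟨hc, hcpt, hi⟩ := hK
  have h0 := zero_mem_interior hc hcpt hi hcen
  have hmp := milman_pajor hc hcpt hi hcen
  have : Nonempty (Fin n) := ⟨⟨0, hn⟩⟩
  let B : Module.Basis (Fin n) ℝ (Euc n) := basisOfLinearIndependentOfCardEqFinrank hb (by simp)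
  have hB : (B : Fin n → Euc n) = b := coe_basisOfLinearIndependentOfCardEqFinrank hb (by simp)
  have hΛ : ∀ x, x ∈ latticeOf b ↔ x ∈ Submodule.span ℤ (range B) := by
    intro x
    rw [hB, Submodule.mem_span_range_iff_exists_fun]
    constructor
    · rintro ⟨z, rfl⟩
      exact ⟨z, Finset.sum_congr rfl fun i _ => by rw [Int.cast_smul_eq_zsmul]⟩
    · rintro ⟨z, rfl⟩
      exact ⟨z, Finset.sum_congr rfl fun i _ => by rw [Int.cast_smul_eq_zsmul]⟩
  have hΛ' : latticeOf b = (Submodule.span ℤ (range B) : Set (Euc n)) := Set.ext hΛ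
  set C := interior (K ∩ -K) with hCdef
  have hCc : Convex ℝ (K ∩ -K) := hc.inter hc.neg
  have hsym : ∀ x ∈ C, -x ∈ C := by
    intro x hx
    have h1 : -C = C := by
      rw [hCdef, ← interior_neg_euc]; congr 1
      ext y; simp [and_comm]
    rw [← h1]; simpa using hx
  have h0C : (0 : Euc n) ∈ C := by
    rw [hCdef, interior_inter, interior_neg_euc]
    exact ⟨h0, by simpa using h0⟩
  have hpos : ∀ i < n, 0 < succMin K (latticeOf b) (i+1) :=
    fun i hi => succ_pos hcpt h0 b hb _ hΛ hi
  have hm := mink2 (Submodule.span ℤ (range B)) (ZSpan.fundamentalDomain_measurableSet B)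
    (ZSpan.isAddFundamentalDomain B volume) hn (C := C) isOpen_interior hCc.interior hsym h0C
    (fun i => succMin K (latticeOf b) (i+1)) hpos
    (fun i hi => succ_mono h0 b hb (by omega))
    (fun i hi v hv => by
      rw [← hΛ']
      exact succ_excl isOpen_interior (interior_subset.trans inter_subset_left) _ (hpos i hi) v hv)
  have hvC : volume C = volume (K ∩ -K) :=
    measure_congr (interior_ae_eq_of_null_frontier (hCc.addHaar_frontier volume))
  rw [vol_fd, hB, Measure.addHaar_smul volume (1/2 : ℝ) C, finrank_euclideanSpace_fin, hvC] at hm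
  have hdet : 0 ≤ latticeDet b := abs_nonneg _
  have hP : 0 < ∏ i ∈ Finset.range n, succMin K (latticeOf b) (i+1) :=
    Finset.prod_pos fun i hi => hpos i (Finset.mem_range.1 hi)
  have hm2 := ENNReal.toReal_mono ENNReal.ofReal_ne_top hm
  rw [ENNReal.toReal_mul, ENNReal.toReal_mul, ENNReal.toReal_ofReal hP.le,
    ENNReal.toReal_ofReal (abs_nonneg _), ENNReal.toReal_ofReal hdet, abs_of_pos (by positivity)] at hm2
  rw [Fin.prod_univ_eq_prod_range (fun i => (succMin K (latticeOf b) (i+1))⁻¹) n, Finset.prod_inv_distrib]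
  set P := ∏ i ∈ Finset.range n, succMin K (latticeOf b) (i+1) with hPdef
  refine div_le_of_le_mul₀ hdet (by positivity) ?_
  have h4 : P * ((1/2 : ℝ)^n * (((2:ℝ)^n)⁻¹ * (volume K).toReal)) ≤ latticeDet b :=
    le_trans (by gcongr) hm2
  have h5 : (4:ℝ)^n = 2^n * 2^n := by rw [← mul_pow]; norm_num
  have e : (volume K).toReal = 4^n * P⁻¹ * (P * ((1/2 : ℝ)^n * (((2:ℝ)^n)⁻¹ * (volume K).toReal))) := by
    rw [h5, one_div, inv_pow]
    field_simp
  rw [e]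
  gcongr

end Paper
end
end

section
/- Let K be an o-symmetric convex body in ℝ^n and write λ_i = λ_i(K,ℤ^n) for 1 ≤ i ≤ n. Then S(K)/vol(K) ≥ (1/(n−1)!)·√(λ_1² + ⋯ + λ_n²). -/
open MeasureTheory Set Filter Pointwise RealInnerProductSpace
open scoped ENNReal

noncomputable section

namespace Paper

variable {n : ℕ}

lemma aux_limit (G : ℝ → ℝ) (c : ℝ) (h0 : ∀ x, 0 < x → 0 ≤ G x)
    (hadd : ∀ a b, 0 < a → 0 < b → G a + G b ≤ G (a + b))
    (hc : ∀ x, 0 < x → c * x ≤ G x) :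
    ∃ L, c ≤ L ∧ Tendsto (fun x => G x / x) (nhdsWithin (0 : ℝ) (Ioi 0)) (nhds L) := by
  set S : Set ℝ := (fun x => G x / x) '' Ioi 0
  have hSne : S.Nonempty := ⟨_, 1, by simp, rfl⟩
  have hSb : BddBelow S := ⟨0, by
    rintro _ ⟨x, hx, rfl⟩
    exact div_nonneg (h0 x hx) (le_of_lt hx)⟩
  refine ⟨sInf S, le_csInf hSne ?_, ?_⟩
  · rintro _ ⟨x, hx, rfl⟩
    exact (le_div_iff₀ hx).2 (hc x hx)
  have hmul : ∀ (d : ℝ), 0 < d → ∀ k : ℕ, ((k : ℝ) + 1) * G d ≤ G (((k : ℝ) + 1) * d) := by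
    intro d hd k
    induction k with
    | zero => simp
    | succ k ih =>
      have := hadd (((k : ℝ) + 1) * d) d (by positivity) hd
      push_cast
      rw [show ((k : ℝ) + 1 + 1) * d = ((k : ℝ) + 1) * d + d by ring]
      linarith
  have hmono : ∀ a b, 0 < a → a ≤ b → G a ≤ G b := by
    intro a b ha hab
    rcases hab.eq_or_lt with rfl | h
    · exact le_rfl
    · have := hadd a (b - a) ha (by linarith)
      have h2 := h0 (b - a) (by linarith)
      rw [show a + (b - a) = b by ring] at this
      linarith
  rw [tendsto_order]
  constructor
  · intro a ha
    filter_upwards [self_mem_nhdsWithin] with x hx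
    exact lt_of_lt_of_le ha (csInf_le hSb ⟨x, hx, rfl⟩)
  · intro a ha
    obtain ⟨_, ⟨e, he, rfl⟩, hlt⟩ := exists_lt_of_csInf_lt hSne ha
    have he : 0 < e := he
    have hcont : Tendsto (fun d => G e / (e - d)) (nhdsWithin (0 : ℝ) (Ioi 0)) (nhds (G e / (e - 0))) := by
      apply Tendsto.mono_left _ nhdsWithin_le_nhds
      apply Tendsto.div tendsto_const_nhds _ (by simpa using he.ne')
      exact tendsto_const_nhds.sub tendsto_id
    rw [sub_zero] at hcont
    filter_upwards [self_mem_nhdsWithin, hcont.eventually (gt_mem_nhds hlt),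
      nhdsWithin_le_nhds (gt_mem_nhds he)] with d hd h1 hde
    have hd : 0 < d := hd
    refine lt_of_le_of_lt ?_ h1
    have hk1 : 1 ≤ ⌊e / d⌋₊ := by
      rw [Nat.one_le_floor_iff, one_le_div hd]; exact hde.le
    obtain ⟨k, hk⟩ : ∃ k, ⌊e / d⌋₊ = k + 1 := ⟨⌊e / d⌋₊ - 1, by omega⟩
    have hle : ((k : ℝ) + 1) * d ≤ e := by
      have := Nat.floor_le (a := e / d) (by positivity)
      rw [hk, le_div_iff₀ hd] at this
      push_cast at this; exact this
    have hge : e - d ≤ ((k : ℝ) + 1) * d := by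
      have := Nat.lt_floor_add_one (e / d)
      rw [hk, div_lt_iff₀ hd] at this
      push_cast at this; linarith
    have h3 := (hmul d hd k).trans (hmono _ _ (by positivity) hle)
    rw [div_le_div_iff₀ hd (by linarith)]
    calc G d * (e - d) ≤ G d * (((k : ℝ) + 1) * d) := mul_le_mul_of_nonneg_left hge (h0 d hd)
      _ = (((k : ℝ) + 1) * G d) * d := by ring
      _ ≤ G e * d := mul_le_mul_of_nonneg_right h3 hd.le

lemma aux_expand {n : ℕ} (T U : Set (Euc n)) (g : Euc n → Euc n) (hg : MapsTo g T U)
    (hexp : ∀ x ∈ T, ∀ y ∈ T, dist x y ≤ dist (g x) (g y)) : volume T ≤ volume U := by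
  have hinj : InjOn g T := by
    intro x hx y hy h
    have := hexp x hx y hy
    rw [h, dist_self] at this
    exact dist_le_zero.1 this
  have hf : LipschitzOnWith 1 (Function.invFunOn g T) (g '' T) := by
    apply LipschitzOnWith.of_dist_le_mul
    rintro _ ⟨x, hx, rfl⟩ _ ⟨y, hy, rfl⟩
    rw [hinj.leftInvOn_invFunOn hx, hinj.leftInvOn_invFunOn hy]
    simpa using hexp x hx y hy
  have h1 := hf.hausdorffMeasure_image_le (d := (Module.finrank ℝ (Euc n) : ℝ)) (by positivity)
  rw [hinj.leftInvOn_invFunOn.image_image] at h1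
  simp only [ENNReal.coe_one, ENNReal.one_rpow, one_mul] at h1
  have h2 := h1.trans (measure_mono hg.image_subset)
  rw [Measure.isAddLeftInvariant_eq_smul (volume : Measure (Euc n)) (μH[(Module.finrank ℝ (Euc n) : ℝ)])]
  simp only [Measure.smul_apply]
  gcongr

lemma aux_superadd {n : ℕ} (K : Set (Euc n)) (hc : Convex ℝ K) (hK : IsCompact K)
    (hne : K.Nonempty) (a b : ℝ) (ha : 0 < a) (hb : 0 < b) :
    volume (Metric.cthickening a K \ K) ≤
      volume (Metric.cthickening (a + b) K \ Metric.cthickening b K) := by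
  have hproj : ∀ y : Euc n, ∃ p ∈ K, ‖y - p‖ = Metric.infDist y K ∧
      ∀ w ∈ K, ⟪y - p, w - p⟫ ≤ 0 := by
    intro y
    obtain ⟨p, hp, hd⟩ := hK.exists_infDist_eq_dist hne y
    refine ⟨p, hp, by rw [hd, dist_eq_norm], ?_⟩
    rw [← norm_eq_iInf_iff_real_inner_le_zero hc hp]
    rw [← dist_eq_norm, ← hd, Metric.infDist_eq_iInf]
    simp [dist_eq_norm]
  choose p hp hpd hpi using hproj
  set N : Euc n → Euc n := fun y => (‖y - p y‖)⁻¹ • (y - p y) with hN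
  have hpos : ∀ y ∉ K, 0 < ‖y - p y‖ := by
    intro y hy
    rw [norm_pos_iff, sub_ne_zero]
    rintro h
    exact hy (h ▸ hp y)
  have hN1 : ∀ y ∉ K, ‖N y‖ = 1 := by
    intro y hy
    rw [hN, norm_smul, norm_inv, norm_norm, inv_mul_cancel₀ (hpos y hy).ne']
  have hNy : ∀ y ∉ K, y = p y + ‖y - p y‖ • N y := by
    intro y hy
    rw [hN, smul_smul, mul_inv_cancel₀ (hpos y hy).ne']; simp
  have hNi : ∀ y, ∀ w ∈ K, ⟪N y, w - p y⟫ ≤ 0 := by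
    intro y w hw
    rw [hN, real_inner_smul_left]
    exact mul_nonpos_of_nonneg_of_nonpos (by positivity) (hpi y w hw)
  have memc : ∀ (r : ℝ), 0 < r → ∀ x, x ∈ Metric.cthickening r K ↔ Metric.infDist x K ≤ r := by
    intro r hr x
    rw [hK.cthickening_eq_biUnion_closedBall hr.le]
    constructor
    · intro h
      simp only [mem_iUnion, Metric.mem_closedBall] at h
      obtain ⟨k, hk, h⟩ := h
      exact (Metric.infDist_le_dist_of_mem hk).trans h
    · intro h
      simp only [mem_iUnion, Metric.mem_closedBall]
      exact ⟨p x, hp x, by rw [dist_eq_norm, hpd]; exact h⟩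
  apply aux_expand _ _ (fun y => y + b • N y)
  · rintro y ⟨hy1, hy2⟩
    rw [memc a ha, ← hpd] at hy1
    rw [Set.mem_sdiff, memc _ (by linarith), memc _ hb, not_le]
    have e : y + b • N y - p y = (‖y - p y‖ + b) • N y := by
      nth_rewrite 1 [hNy y hy2]
      module
    constructor
    · refine (Metric.infDist_le_dist_of_mem (hp y)).trans ?_
      rw [dist_eq_norm, e, norm_smul, hN1 y hy2, Real.norm_of_nonneg (by positivity)]
      linarith
    · set z := y + b • N y
      have h1 := hNi y (p z) (hp z)
      have h2 : ⟪N y, z - p z⟫ = (‖y - p y‖ + b) - ⟪N y, p z - p y⟫ := by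
        rw [show z - p z = (z - p y) - (p z - p y) by abel, e, inner_sub_right,
          real_inner_smul_right, real_inner_self_eq_norm_sq, hN1 y hy2]; ring
      have h3 := real_inner_le_norm (N y) (z - p z)
      rw [hN1 y hy2, one_mul, hpd] at h3
      have := hpos y hy2
      linarith
  · rintro x ⟨-, hx⟩ y ⟨-, hy⟩
    rw [dist_eq_norm, dist_eq_norm]
    have e : x + b • N x - (y + b • N y) = (x - y) + b • (N x - N y) := by module
    rw [e]
    have key : 0 ≤ ⟪x - y, N x - N y⟫ := by
      have h1 := hNi x (p y) (hp y)
      have h2 := hNi y (p x) (hp x)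
      have h3 := real_inner_le_norm (N x) (N y)
      rw [hN1 x hx, hN1 y hy] at h3
      have hxy : x - y = ‖x - p x‖ • N x - ‖y - p y‖ • N y + (p x - p y) := by
        nth_rewrite 1 [hNy x hx, hNy y hy]; module
      have h4 : ⟪x - y, N x - N y⟫ = (‖x - p x‖ + ‖y - p y‖) * (1 - ⟪N x, N y⟫)
          - ⟪N x, p y - p x⟫ - ⟪N y, p x - p y⟫ := by
        nth_rewrite 1 [hxy]
        simp only [inner_add_left, inner_sub_left, inner_sub_right, real_inner_smul_left,
          real_inner_self_eq_norm_sq, hN1 x hx, hN1 y hy]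
        rw [real_inner_comm (N x) (p x), real_inner_comm (N x) (p y),
          real_inner_comm (N y) (p x), real_inner_comm (N y) (p y), real_inner_comm (N x) (N y)]
        ring
      have h5 : 0 ≤ (‖x - p x‖ + ‖y - p y‖) * (1 - ⟪N x, N y⟫) :=
        mul_nonneg (by positivity) (by linarith)
      linarith
    refine (sq_le_sq₀ (norm_nonneg _) (norm_nonneg _)).1 ?_
    rw [norm_add_sq_real, real_inner_smul_right]
    have : 0 ≤ b * ⟪x - y, N x - N y⟫ := mul_nonneg hb.le key
    nlinarith [sq_nonneg ‖b • (N x - N y)‖]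

lemma aux_fubini {m : ℕ} (j : Fin (m + 1)) (E : Set (Euc (m + 1))) (hE : MeasurableSet E) :
    Measurable (fun y : Fin m → ℝ =>
      volume {t : ℝ | (WithLp.toLp 2 (j.insertNth t y : Fin (m+1) → ℝ) : Euc (m + 1)) ∈ E}) ∧
    volume E = ∫⁻ y : Fin m → ℝ,
      volume {t : ℝ | (WithLp.toLp 2 (j.insertNth t y : Fin (m+1) → ℝ) : Euc (m + 1)) ∈ E} := by
  have h1 := (volume_preserving_piFinSuccAbove (fun _ : Fin (m + 1) => ℝ) j).symm
  have h2 := (PiLp.volume_preserving_toLp (Fin (m + 1))).comp h1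
  have h3 := h2.measure_preimage hE.nullMeasurableSet
  have hm := h2.measurable hE
  constructor
  · exact measurable_measure_prodMk_right hm
  · rw [← h3]
    exact Measure.prod_apply_symm hm

lemma aux_1d (A B : Set ℝ) (s : ℝ) (hs : 0 ≤ s) (hA : IsCompact A) (hne : A.Nonempty)
    (h : ∀ x ∈ A, ∀ t, |t| ≤ s → x + t ∈ B) :
    volume A + ENNReal.ofReal (2 * s) ≤ volume B := by
  obtain ⟨M, hM, hmax⟩ := hA.exists_isGreatest hne
  have h1 : volume ((fun x => x + s) ⁻¹' A) = volume A := measure_preimage_add_right _ _ _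
  have h2 : volume (Ioc (M - s) (M + s)) = ENNReal.ofReal (2 * s) := by
    rw [Real.volume_Ioc]; congr 1; ring
  rw [← h1, ← h2, ← measure_union _ measurableSet_Ioc]
  · apply measure_mono
    rintro x (hx | ⟨hx1, hx2⟩)
    · have := h _ hx (-s) (by rw [abs_neg, abs_of_nonneg hs])
      simpa using this
    · have := h _ hM (x - M) (abs_le.2 ⟨by linarith, by linarith⟩)
      simpa using this
  · rw [Set.disjoint_left]
    rintro x hx ⟨hx1, -⟩
    have := hmax hx
    linarith

lemma aux_ins {m : ℕ} (j : Fin (m + 1)) (t u : ℝ) (y : Fin m → ℝ) :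
    (WithLp.toLp 2 (j.insertNth (t + u) y : Fin (m+1) → ℝ) : Euc (m + 1)) =
      WithLp.toLp 2 (j.insertNth t y : Fin (m+1) → ℝ) + u • EuclideanSpace.single j (1 : ℝ) := by
  ext i
  refine Fin.succAboveCases j ?_ (fun i => ?_) i
  · simp
  · simp [Fin.succAbove_ne]

lemma aux_cont {m : ℕ} (j : Fin (m + 1)) (y : Fin m → ℝ) : Continuous fun t : ℝ =>
    (WithLp.toLp 2 (j.insertNth t y : Fin (m+1) → ℝ) : Euc (m + 1)) := by
  have : (fun t : ℝ => (WithLp.toLp 2 (j.insertNth t y : Fin (m+1) → ℝ) : Euc (m + 1))) =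
    fun t => WithLp.toLp 2 (j.insertNth (0 : ℝ) y : Fin (m+1) → ℝ) +
      t • EuclideanSpace.single j (1 : ℝ) := by
    ext1 t
    rw [← aux_ins, zero_add]
  rw [this]
  fun_prop

lemma aux_fiber {m : ℕ} (j : Fin (m + 1)) (K L M : Set (Euc (m + 1))) (a s : ℝ) (ha : 0 < a)
    (hs : 0 ≤ s) (hK : IsCompact K) (hL : IsCompact L) (hM : IsCompact M) (hKL : K ⊆ L)
    (hLM : ∀ x ∈ L, ∀ t : ℝ, |t| ≤ s → x + t • EuclideanSpace.single j (1 : ℝ) ∈ M)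
    (hKa : ∀ x ∈ K, ∀ t : ℝ, x + t • EuclideanSpace.single j (1 : ℝ) ∈ K → |t| ≤ 2 * a) :
    volume L + ENNReal.ofReal (s / a) * volume K ≤ volume M := by
  set P : Set (Fin m → ℝ) := (fun x : Euc (m + 1) => fun i => x (j.succAbove i)) '' K with hP
  have hPm : MeasurableSet P := by
    apply IsCompact.measurableSet
    apply hK.image
    fun_prop
  have hPmem : ∀ y t, (WithLp.toLp 2 (j.insertNth t y : Fin (m+1) → ℝ) : Euc (m + 1)) ∈ K →
      y ∈ P := by
    intro y t h
    refine ⟨_, h, ?_⟩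
    ext i
    simp
  have hPmem' : ∀ y ∈ P, ∃ t, (WithLp.toLp 2 (j.insertNth t y : Fin (m+1) → ℝ) : Euc (m + 1)) ∈ K := by
    rintro _ ⟨x, hx, rfl⟩
    refine ⟨x j, ?_⟩
    have e : (WithLp.toLp 2 (j.insertNth (x j) (fun i => x (j.succAbove i)) : Fin (m+1) → ℝ) :
        Euc (m + 1)) = x := by
      ext i
      refine Fin.succAboveCases j ?_ (fun i => ?_) i <;> simp
    rw [e]
    exact hx
  obtain ⟨-, eK⟩ := aux_fubini j K hK.measurableSet
  obtain ⟨mL, eL⟩ := aux_fubini j L hL.measurableSet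
  obtain ⟨-, eM⟩ := aux_fubini j M hM.measurableSet
  have vK : volume K ≤ ENNReal.ofReal (2 * a) * volume P := by
    rw [eK, ← lintegral_indicator_const hPm]
    apply lintegral_mono
    intro y
    by_cases hy : y ∈ P
    · simp only [hy, indicator_of_mem]
      refine (Real.volume_le_diam _).trans ?_
      apply Metric.ediam_le
      intro t ht u hu
      rw [edist_dist]
      apply ENNReal.ofReal_le_ofReal
      rw [dist_comm, Real.dist_eq]
      apply hKa _ ht
      rw [← aux_ins]
      simpa using hu
    · simp only [hy, not_false_eq_true, indicator_of_notMem, nonpos_iff_eq_zero]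
      convert measure_empty (μ := (volume : Measure ℝ))
      rw [Set.eq_empty_iff_forall_notMem]
      intro t ht
      exact hy (hPmem y t ht)
  have vM : volume L + ENNReal.ofReal (2 * s) * volume P ≤ volume M := by
    rw [eL, eM, ← lintegral_indicator_const hPm, ← lintegral_add_left mL]
    apply lintegral_mono
    intro y
    by_cases hy : y ∈ P
    · simp only [hy, indicator_of_mem]
      apply aux_1d _ _ s hs
      · have hcl : IsClosed {t : ℝ | (WithLp.toLp 2 (j.insertNth t y : Fin (m+1) → ℝ) : Euc (m + 1)) ∈ L} :=
          hL.isClosed.preimage (aux_cont j y)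
        refine Metric.isCompact_of_isClosed_isBounded hcl ?_
        have hev : Continuous fun x : Euc (m + 1) => x j := by fun_prop
        refine (hL.image hev).isBounded.subset ?_
        intro t ht
        exact ⟨_, ht, by simp⟩
      · obtain ⟨t, ht⟩ := hPmem' y hy
        exact ⟨t, hKL ht⟩
      · intro t ht u hu
        change _ ∈ M
        rw [aux_ins]
        exact hLM _ ht u hu
    · simp only [hy, not_false_eq_true, indicator_of_notMem, add_zero]
      apply measure_mono
      intro t ht
      have := hLM _ ht 0 (by simpa using hs)
      simpa using this
  refine le_trans (add_le_add_right ?_ _) vM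
  calc ENNReal.ofReal (s / a) * volume K
      ≤ ENNReal.ofReal (s / a) * (ENNReal.ofReal (2 * a) * volume P) := by gcongr
    _ = ENNReal.ofReal (2 * s) * volume P := by
      rw [← mul_assoc, ← ENNReal.ofReal_mul (by positivity)]
      congr 2
      field_simp

lemma aux_chain {m : ℕ} (K : Set (Euc (m + 1))) (hK : IsCompact K) (a s : Fin (m + 1) → ℝ)
    (ha : ∀ i, 0 < a i) (hs : ∀ i, 0 ≤ s i)
    (hKa : ∀ j, ∀ x ∈ K, ∀ t : ℝ, x + t • EuclideanSpace.single j (1 : ℝ) ∈ K → |t| ≤ 2 * a j)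
    (J : Finset (Fin (m + 1))) :
    ∃ L : Set (Euc (m + 1)), IsCompact L ∧ K ⊆ L ∧
      (∀ x ∈ L, ∃ k ∈ K, ∀ i, |x i - k i| ≤ if i ∈ J then s i else 0) ∧
      volume K + ∑ i ∈ J, ENNReal.ofReal (s i / a i) * volume K ≤ volume L := by
  classical
  induction J using Finset.induction_on with
  | empty => exact ⟨K, hK, Subset.rfl, fun x hx => ⟨x, hx, by simp⟩, by simp⟩
  | insert j J hj ih =>
    obtain ⟨L, hL, hKL, hLk, hv⟩ := ih
    have hI : IsCompact ((fun t : ℝ => t • (EuclideanSpace.single j (1 : ℝ) : Euc (m + 1))) ''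
        Icc (-s j) (s j)) := isCompact_Icc.image (by fun_prop)
    have hsub : ∀ x ∈ L, ∀ t : ℝ, |t| ≤ s j → x + t • EuclideanSpace.single j (1 : ℝ) ∈
        L + ((fun t : ℝ => t • (EuclideanSpace.single j (1 : ℝ) : Euc (m + 1))) ''
        Icc (-s j) (s j)) := fun x hx t ht => add_mem_add hx ⟨t, abs_le.1 ht, rfl⟩
    refine ⟨_, hL.add hI, ?_, ?_, ?_⟩
    · intro x hx
      have := hsub x (hKL hx) 0 (by simpa using hs j)
      simpa using this
    · rintro _ ⟨x, hx, _, ⟨t, ht, rfl⟩, rfl⟩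
      obtain ⟨k, hk, h⟩ := hLk x hx
      refine ⟨k, hk, fun i => ?_⟩
      by_cases hij : i = j
      · subst hij
        have := h i
        simp only [hj, if_false, abs_nonpos_iff, sub_eq_zero] at this
        simp [this, abs_le.2 ht]
      · have := h i
        simpa [hij] using this
    · have := aux_fiber j K L _ (a j) (s j) (ha j) (hs j) hK hL (hL.add hI) hKL hsub (hKa j)
      refine le_trans ?_ this
      rw [Finset.sum_insert hj, add_comm (ENNReal.ofReal _ * _), ← add_assoc]
      gcongr

lemma aux_max {n : ℕ} (K : Set (Euc n)) (hK : IsConvexBody K) (hsym : K = -K) (i : Fin n) :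
    ∃ a : ℝ, 0 < a ∧ a • (EuclideanSpace.single i (1 : ℝ) : Euc n) ∈ K ∧
      ∀ t : ℝ, t • (EuclideanSpace.single i (1 : ℝ) : Euc n) ∈ K → t ≤ a := by
  obtain ⟨hc, hk, x, hx⟩ := hK
  obtain ⟨r, hr, hball⟩ := Metric.isOpen_iff.1 isOpen_interior x hx
  have hneg : ∀ z ∈ K, -z ∈ K := fun z hz => by rw [hsym] at hz; exact hz
  have h0 : ∀ z : Euc n, ‖z‖ < r → z ∈ K := by
    intro z hz
    have h1 : x + z ∈ K := interior_subset (hball (by simpa using hz))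
    have h2 : x - z ∈ K := interior_subset (hball (by simpa [dist_eq_norm] using hz))
    have := hc h1 (hneg _ h2) (a := 1/2) (b := 1/2) (by norm_num) (by norm_num) (by norm_num)
    convert this using 1
    module
  set S : Set ℝ := {t : ℝ | t • (EuclideanSpace.single i (1 : ℝ) : Euc n) ∈ K}
  have hS : IsCompact S := by
    have hev : Continuous fun x : Euc n => x i := by fun_prop
    refine Metric.isCompact_of_isClosed_isBounded (hk.isClosed.preimage (by fun_prop)) ?_
    refine (hk.image hev).isBounded.subset ?_
    intro t ht
    exact ⟨_, ht, by simp⟩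
  have hr2 : r / 2 ∈ S := by
    apply h0
    rw [norm_smul]
    simp [abs_of_pos hr]
    linarith
  obtain ⟨a, ha, hmax⟩ := hS.exists_isGreatest ⟨_, hr2⟩
  exact ⟨a, lt_of_lt_of_le (by positivity) (hmax hr2), ha, fun t ht => hmax ht⟩

lemma aux_width {n : ℕ} (K : Set (Euc n)) (hc : Convex ℝ K) (hsym : K = -K) (i : Fin n) (a : ℝ)
    (ha : ∀ t : ℝ, t • (EuclideanSpace.single i (1 : ℝ) : Euc n) ∈ K → t ≤ a) :
    ∀ x ∈ K, ∀ t : ℝ, x + t • EuclideanSpace.single i (1 : ℝ) ∈ K → |t| ≤ 2 * a := by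
  intro x hx t ht
  have hneg : ∀ z ∈ K, -z ∈ K := fun z hz => by rw [hsym] at hz; exact hz
  have h1 := hc ht (hneg _ hx) (a := 1/2) (b := 1/2) (by norm_num) (by norm_num) (by norm_num)
  have h2 : (t / 2) • (EuclideanSpace.single i (1 : ℝ) : Euc n) ∈ K := by
    convert h1 using 1
    module
  have h3 : (-(t / 2)) • (EuclideanSpace.single i (1 : ℝ) : Euc n) ∈ K := by
    rw [neg_smul]; exact hneg _ h2
  have h4 := ha _ h2
  have h5 := ha _ h3
  exact abs_le.2 ⟨by linarith, by linarith⟩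

lemma aux_succMin {n : ℕ} (K : Set (Euc n)) (hc : Convex ℝ K) (hz : (0 : Euc n) ∈ K)
    (a : Fin n → ℝ) (ha : ∀ i, 0 < a i)
    (haK : ∀ i, a i • (EuclideanSpace.single i (1 : ℝ) : Euc n) ∈ K) :
    ∑ i : Fin n, (succMin K (stdLattice n) ((i : ℕ) + 1)) ^ 2 ≤ ∑ i, (1 / a i) ^ 2 := by
  set c : Fin n → ℝ := fun i => 1 / a i with hcdef
  set σ := Tuple.sort c
  have hmon : Monotone (c ∘ σ) := Tuple.monotone_sort c
  rw [← Equiv.sum_comp σ (fun i => (1 / a i) ^ 2)]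
  apply Finset.sum_le_sum
  intro i _
  have hpos : 0 ≤ succMin K (stdLattice n) ((i : ℕ) + 1) := by
    apply Real.sInf_nonneg
    rintro t ⟨ht, -⟩
    exact ht.le
  apply pow_le_pow_left₀ hpos
  apply csInf_le ⟨0, fun t ht => ht.1.le⟩
  have hi : 0 < a (σ i) := ha _
  refine ⟨by positivity, fun j => EuclideanSpace.single (σ (Fin.castLE (by omega) j)) (1 : ℝ),
    ?_, fun j => ⟨?_, ?_⟩⟩
  · have h1 := (EuclideanSpace.orthonormal_single (𝕜 := ℝ) (ι := Fin n)).linearIndependent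
    exact h1.comp (fun j : Fin ((i : ℕ) + 1) => σ (Fin.castLE (by omega) j))
      (σ.injective.comp (Fin.castLE_injective (by omega)))
  · intro k
    by_cases h : k = σ (Fin.castLE (by omega) j)
    · exact ⟨1, by simp [h]⟩
    · exact ⟨0, by simp [h]⟩
  · set l := σ (Fin.castLE (by omega) j) with hl
    have hle : 1 / a l ≤ 1 / a (σ i) := hmon (show Fin.castLE (by omega) j ≤ i from by
      rw [Fin.le_def]; simp; omega)
    have hle2 : a (σ i) ≤ a l := (one_div_le_one_div (ha l) hi).1 hle
    rw [mem_smul_set_iff_inv_smul_mem₀ (by positivity)]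
    have h2 := hc.smul_mem_of_zero_mem hz (haK l) (t := a (σ i) / a l)
      ⟨by have := ha l; positivity, (div_le_one (ha l)).2 hle2⟩
    rw [smul_smul, div_mul_cancel₀ _ (ha l).ne'] at h2
    simpa using h2

/-- `S(K)/vol(K) ≥ (1/(n-1)!)·√(λ_1² + ⋯ + λ_n²)` for `o`-symmetric convex bodies. -/
theorem statement18 {n : ℕ} (hn : 0 < n) (K : Set (Euc n))
    (hK : IsConvexBody K) (hsym : K = -K) :
    surfaceArea K / (volume K).toReal ≥
      ((1 : ℝ) / (n - 1).factorial) *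
        Real.sqrt (∑ i : Fin n, (succMin K (stdLattice n) ((i : ℕ) + 1)) ^ 2) := by
  obtain ⟨m, rfl⟩ : ∃ m, n = m + 1 := ⟨n - 1, by omega⟩
  choose a ha haK hamax using aux_max K hK hsym
  obtain ⟨hc, hk, hint⟩ := hK
  have hneg : ∀ z ∈ K, -z ∈ K := fun z hz => by rw [hsym] at hz; exact hz
  have hz : (0 : Euc (m + 1)) ∈ K := by
    have := hc (haK 0) (hneg _ (haK 0)) (a := 1/2) (b := 1/2) (by norm_num) (by norm_num)
      (by norm_num)
    convert this using 1
    module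
  have hw := fun i => aux_width K hc hsym i (a i) (hamax i)
  have hsm := aux_succMin K hc hz a ha haK
  set C : ℝ := Real.sqrt (∑ i, (1 / a i) ^ 2) with hC
  have hsumpos : 0 < ∑ i, (1 / a i) ^ 2 :=
    Finset.sum_pos (fun i _ => by have := ha i; positivity) ⟨0, Finset.mem_univ _⟩
  have hCpos : 0 < C := Real.sqrt_pos.2 hsumpos
  have hC2 : C ^ 2 = ∑ i, (1 / a i) ^ 2 := Real.sq_sqrt hsumpos.le
  have hfin : ∀ r, volume (Metric.cthickening r K) ≠ ∞ := fun r => hk.cthickening.measure_lt_top.ne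
  have hfinK : volume K ≠ ∞ := hk.measure_lt_top.ne
  set V : ℝ := (volume K).toReal with hV
  have hVpos : 0 < V := ENNReal.toReal_pos
    ((isOpen_interior.measure_pos _ hint).trans_le (measure_mono interior_subset)).ne' hfinK
  set G : ℝ → ℝ := fun e => (volume (Metric.cthickening e K)).toReal - V with hG
  have hlow : ∀ x, 0 < x → (V * C) * x ≤ G x := by
    intro e he
    obtain ⟨L, hL, hKL, hLk, hv⟩ := aux_chain K hk a (fun i => e * ((1 / a i) / C)) ha
      (fun i => by have := ha i; positivity) hw Finset.univ
    have hsub : L ⊆ Metric.cthickening e K := by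
      intro x hx
      obtain ⟨k, hkK, h⟩ := hLk x hx
      refine Metric.mem_cthickening_of_dist_le x k e K hkK ?_
      rw [EuclideanSpace.dist_eq]
      refine Real.sqrt_le_iff.2 ⟨he.le, ?_⟩
      calc ∑ i, dist (x i) (k i) ^ 2 ≤ ∑ i, (e * ((1 / a i) / C)) ^ 2 := by
            apply Finset.sum_le_sum
            intro i _
            have := h i
            simp only [Finset.mem_univ, if_true] at this
            exact pow_le_pow_left₀ dist_nonneg (by rwa [Real.dist_eq]) 2
        _ = e ^ 2 * ((∑ i, (1 / a i) ^ 2) / C ^ 2) := by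
            rw [Finset.sum_div, Finset.mul_sum]
            apply Finset.sum_congr rfl
            intro i _
            ring
        _ = e ^ 2 := by rw [← hC2, div_self (by positivity), mul_one]
    have h1 := ENNReal.toReal_mono (hfin e) (hv.trans (measure_mono hsub))
    rw [← Finset.sum_mul, ← ENNReal.ofReal_sum_of_nonneg (fun i _ => by have := ha i; positivity),
      ENNReal.toReal_add hfinK (ENNReal.mul_ne_top ENNReal.ofReal_ne_top hfinK),
      ENNReal.toReal_mul, ENNReal.toReal_ofReal
        (Finset.sum_nonneg (fun i _ => by have := ha i; positivity))] at h1
    have h2 : ∑ i, e * ((1 / a i) / C) / a i = e * C := by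
      have : ∑ i, e * ((1 / a i) / C) / a i = e * ((∑ i, (1 / a i) ^ 2) / C) := by
        rw [Finset.sum_div, Finset.mul_sum]
        apply Finset.sum_congr rfl
        intro i _
        ring
      rw [this, ← hC2]
      field_simp
    rw [h2] at h1
    simp only [hG]
    nlinarith [h1]
  have hadd : ∀ x y, 0 < x → 0 < y → G x + G y ≤ G (x + y) := by
    intro x y hx hy
    have h1 := aux_superadd K hc hk ⟨0, hz⟩ x y hx hy
    rw [measure_sdiff (Metric.self_subset_cthickening K) hk.measurableSet.nullMeasurableSet hfinK,
      measure_sdiff (Metric.cthickening_mono (by linarith) K)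
        Metric.isClosed_cthickening.measurableSet.nullMeasurableSet (hfin y)] at h1
    have h2 := ENNReal.toReal_mono (ENNReal.sub_ne_top (hfin _)) h1
    rw [ENNReal.toReal_sub_of_le (measure_mono (Metric.self_subset_cthickening K)) (hfin _),
      ENNReal.toReal_sub_of_le (measure_mono (Metric.cthickening_mono (by linarith) K)) (hfin _)]
      at h2
    simp only [hG]
    linarith
  obtain ⟨l, hl, ht⟩ := aux_limit G (V * C)
    (fun x hx => le_trans (by positivity) (hlow x hx)) hadd hlow
  have hS : surfaceArea K = l := ht.limUnder_eq
  rw [hS, ge_iff_le, le_div_iff₀ hVpos]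
  have h1 : Real.sqrt (∑ i : Fin (m + 1), (succMin K (stdLattice (m + 1)) ((i : ℕ) + 1)) ^ 2) ≤ C :=
    Real.sqrt_le_sqrt hsm
  have h2 : (1 : ℝ) / (m + 1 - 1).factorial ≤ 1 := by
    rw [div_le_one (by positivity)]
    exact_mod_cast Nat.succ_le_of_lt (Nat.factorial_pos _)
  have h3 := mul_le_mul h2 h1 (Real.sqrt_nonneg _) zero_le_one
  calc _ ≤ 1 * C * V := mul_le_mul_of_nonneg_right h3 hVpos.le
    _ = V * C := by ring
    _ ≤ l := hl

end Paper
end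
end
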